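/- arXiv:math/0311381 — 5 statements merged into one kernel-verified Lean document; each statement's English description precedes it below -/
import Mathlib

section
/- Let H be a quasi-bialgebra over a field k and let M be a left-right Yetter–Drinfeld module over H. Then the k-linear map R = R_M : M⊗M → M⊗M defined by R(m⊗n) = ∑ n_(1)·m ⊗ n_(0) satisfies the quasi-Yang–Baxter equation R₁₂ Φ₃₁₂ R₁₃ Φ⁻¹₁₃₂ R₂₃ Φ = Φ₃₂₁ R₂₃ Φ⁻¹₂₃₁ R₁₃ Φ₂₁₃ R₁₂ as endomorphisms of M⊗M⊗M, where R_ij denotes R acting on the i-th and j-th tensor factors, and a permuted tensor Φ_{σ(1)σ(2)σ(3)} acts on M⊗M⊗M by the left H-action on the corresponding factors (e.g. Φ₃₁₂(l⊗m⊗n) = ∑ X²·l ⊗ X³·m ⊗ X¹·n). -/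
open scoped TensorProduct

noncomputable section
structure QuasiBialgebra (k H : Type) [Field k] [Ring H] [Algebra k H] where
  /-- index type for the Sweedler components of `Δ` -/
  J : Type
  [fJ : Fintype J]
  Δ1 : H → J → H
  Δ2 : H → J → H
  Δmap : H →ₐ[k] H ⊗[k] H
  ε : H →ₐ[k] k
  Δ_eq : ∀ h, Δmap h = ∑ j, Δ1 h j ⊗ₜ[k] Δ2 h j
  /-- index type for the components of `Φ` -/
  I : Type
  [fI : Fintype I]
  X1 : I → H
  X2 : I → H
  X3 : I → H
  /-- index type for the components of `Φ⁻¹` -/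
  I' : Type
  [fI' : Fintype I']
  x1 : I' → H
  x2 : I' → H
  x3 : I' → H
  Φ_right_inv :
    (∑ i, X1 i ⊗ₜ[k] (X2 i ⊗ₜ[k] X3 i)) * (∑ a, x1 a ⊗ₜ[k] (x2 a ⊗ₜ[k] x3 a)) = 1
  Φ_left_inv :
    (∑ a, x1 a ⊗ₜ[k] (x2 a ⊗ₜ[k] x3 a)) * (∑ i, X1 i ⊗ₜ[k] (X2 i ⊗ₜ[k] X3 i)) = 1
  quasi_coassoc : ∀ h,
    ∑ j, ∑ j', Δ1 h j ⊗ₜ[k] (Δ1 (Δ2 h j) j' ⊗ₜ[k] Δ2 (Δ2 h j) j')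
      = (∑ i, X1 i ⊗ₜ[k] (X2 i ⊗ₜ[k] X3 i))
        * (∑ j, ∑ j', Δ1 (Δ1 h j) j' ⊗ₜ[k] (Δ2 (Δ1 h j) j' ⊗ₜ[k] Δ2 h j))
        * (∑ a, x1 a ⊗ₜ[k] (x2 a ⊗ₜ[k] x3 a))
  counit_right : ∀ h, ∑ j, ε (Δ2 h j) • Δ1 h j = h
  counit_left : ∀ h, ∑ j, ε (Δ1 h j) • Δ2 h j = h
  cocycle :
    (∑ i, (1 : H) ⊗ₜ[k] (X1 i ⊗ₜ[k] (X2 i ⊗ₜ[k] X3 i)))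
      * (∑ i, ∑ j, X1 i ⊗ₜ[k] (Δ1 (X2 i) j ⊗ₜ[k] (Δ2 (X2 i) j ⊗ₜ[k] X3 i)))
      * (∑ i, X1 i ⊗ₜ[k] (X2 i ⊗ₜ[k] (X3 i ⊗ₜ[k] (1 : H))))
    = (∑ i, ∑ j, X1 i ⊗ₜ[k] (X2 i ⊗ₜ[k] (Δ1 (X3 i) j ⊗ₜ[k] Δ2 (X3 i) j)))
      * (∑ i, ∑ j, Δ1 (X1 i) j ⊗ₜ[k] (Δ2 (X1 i) j ⊗ₜ[k] (X2 i ⊗ₜ[k] X3 i)))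
  Φ_normal : ∑ i, ε (X2 i) • (X1 i ⊗ₜ[k] X3 i) = (1 : H ⊗[k] H)

attribute [instance] QuasiBialgebra.fJ QuasiBialgebra.fI QuasiBialgebra.fI'

section

variable {k H : Type} [Field k] [Ring H] [Algebra k H]

/-- the linear map `h ↦ A * h * C` on `H` -/
def lrH (k : Type) [Field k] {H : Type} [Ring H] [Algebra k H] (A C : H) :
    H →ₗ[k] H :=
  (LinearMap.mulLeft k A).comp (LinearMap.mulRight k C)

variable {M : Type} [AddCommGroup M] [Module k M]

/-- A left-right Yetter-Drinfeld module over a quasi-bialgebra `Q`: a left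
`H`-module (action `act`) with a right `H`-coaction
`coact : M →ₗ M ⊗ H`, `m ↦ ∑ m₍₀₎ ⊗ m₍₁₎`, satisfying the three axioms
(lry1), (lry2), (lry3). -/
structure IsLeftRightYD (Q : QuasiBialgebra k H)
    (act : H →ₗ[k] M →ₗ[k] M) (coact : M →ₗ[k] M ⊗[k] H) : Prop where
  one_act : act 1 = LinearMap.id
  mul_act : ∀ g h, act (g * h) = (act g).comp (act h)
  /-- `∑ (x²·m₍₀₎)₍₀₎ ⊗ (x²·m₍₀₎)₍₁₎x¹ ⊗ x³m₍₁₎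
      = ∑ x¹·(y³·m)₍₀₎ ⊗ x²(y³·m)₍₁₎₁y¹ ⊗ x³(y³·m)₍₁₎₂y²` -/
  lry1 : ∀ m,
    ∑ a, (TensorProduct.map (LinearMap.lTensor M (LinearMap.mulRight k (Q.x1 a)))
        (LinearMap.mulLeft k (Q.x3 a)))
        ((LinearMap.rTensor H (coact.comp (act (Q.x2 a)))) (coact m))
    = ∑ a, ∑ a2, (TensorProduct.assoc k M H H).symm
        ((TensorProduct.map (act (Q.x1 a))
          (TensorProduct.map (lrH k (Q.x2 a) (Q.x1 a2)) (lrH k (Q.x3 a) (Q.x2 a2))))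
          ((LinearMap.lTensor M Q.Δmap.toLinearMap) (coact (act (Q.x3 a2) m))))
  /-- `∑ ε(m₍₁₎) m₍₀₎ = m` -/
  lry2 : ∀ m,
    (TensorProduct.rid k M) ((LinearMap.lTensor M Q.ε.toLinearMap) (coact m)) = m
  /-- `∑ h₁·m₍₀₎ ⊗ h₂m₍₁₎ = ∑ (h₂·m)₍₀₎ ⊗ (h₂·m)₍₁₎h₁` -/
  lry3 : ∀ h m,
    ∑ j, (TensorProduct.map (act (Q.Δ1 h j)) (LinearMap.mulLeft k (Q.Δ2 h j))) (coact m)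
    = ∑ j, (LinearMap.lTensor M (LinearMap.mulRight k (Q.Δ1 h j)))
        (coact (act (Q.Δ2 h j) m))

/-- For a left-right Yetter-Drinfeld module, the map
`R_M : M⊗M → M⊗M`, `R_M(m⊗n) = ∑ n₍₁₎·m ⊗ n₍₀₎`. -/
def ydR (act : H →ₗ[k] M →ₗ[k] M) (coact : M →ₗ[k] M ⊗[k] H) :
    M ⊗[k] M →ₗ[k] M ⊗[k] M :=
  (TensorProduct.lift ((LinearMap.rTensorHom M).comp act)).comp
    ((TensorProduct.leftComm k M H M).toLinearMap.comp
      ((LinearMap.lTensor M (TensorProduct.comm k M H).toLinearMap).comp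
        (LinearMap.lTensor M coact)))

/-- the operator `∑ A·l ⊗ B·m ⊗ C·n` on `M⊗M⊗M` -/
def phiOp3 (act : H →ₗ[k] M →ₗ[k] M) (A B C : H) :
    (M ⊗[k] (M ⊗[k] M)) →ₗ[k] (M ⊗[k] (M ⊗[k] M)) :=
  TensorProduct.map (act A) (TensorProduct.map (act B) (act C))

/-- an endomorphism of `M⊗M` acting on the first two factors of `M⊗M⊗M` -/
def op12 (R : M ⊗[k] M →ₗ[k] M ⊗[k] M) :
    (M ⊗[k] (M ⊗[k] M)) →ₗ[k] (M ⊗[k] (M ⊗[k] M)) :=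
  (TensorProduct.assoc k M M M).toLinearMap.comp
    ((LinearMap.rTensor M R).comp (TensorProduct.assoc k M M M).symm.toLinearMap)

/-- an endomorphism of `M⊗M` acting on the last two factors of `M⊗M⊗M` -/
def op23 (R : M ⊗[k] M →ₗ[k] M ⊗[k] M) :
    (M ⊗[k] (M ⊗[k] M)) →ₗ[k] (M ⊗[k] (M ⊗[k] M)) :=
  LinearMap.lTensor M R

/-- the flip of the last two factors of `M⊗M⊗M` -/
def swap23 : (M ⊗[k] (M ⊗[k] M)) →ₗ[k] (M ⊗[k] (M ⊗[k] M)) :=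
  LinearMap.lTensor M (TensorProduct.comm k M M).toLinearMap

/-- an endomorphism of `M⊗M` acting on the first and third factors of `M⊗M⊗M` -/
def op13 (R : M ⊗[k] M →ₗ[k] M ⊗[k] M) :
    (M ⊗[k] (M ⊗[k] M)) →ₗ[k] (M ⊗[k] (M ⊗[k] M)) :=
  swap23.comp ((op12 R).comp swap23)

end

section

variable {k H : Type} [Field k] [Ring H] [Algebra k H]
variable {M : Type} [AddCommGroup M] [Module k M]

/-- The linear map `n ⊗ h ↦ h·m ⊗ n`. -/
def actSwap (act : H →ₗ[k] M →ₗ[k] M) (m : M) : M ⊗[k] H →ₗ[k] M ⊗[k] M :=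
  (TensorProduct.comm k M M).toLinearMap.comp (LinearMap.lTensor M (act.flip m))

@[simp]
theorem actSwap_tmul (act : H →ₗ[k] M →ₗ[k] M) (m n : M) (h : H) :
    actSwap act m (n ⊗ₜ[k] h) = act h m ⊗ₜ[k] n := by
  simp [actSwap]

theorem ydR_tmul (act : H →ₗ[k] M →ₗ[k] M) (coact : M →ₗ[k] M ⊗[k] H) (m n : M) :
    ydR act coact (m ⊗ₜ[k] n) = actSwap act m (coact n) := by
  simp only [ydR, LinearMap.comp_apply, LinearMap.lTensor_tmul]
  induction coact n using TensorProduct.induction_on with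
  | zero => simp
  | tmul p h => simp
  | add a b ha hb => simp only [map_add, TensorProduct.tmul_add, ha, hb]

/-- The linear map `n ⊗ (g ⊗ h) ↦ g·l ⊗ (h·m ⊗ n)`. -/
def actSwap₂ (act : H →ₗ[k] M →ₗ[k] M) (l m : M) :
    M ⊗[k] (H ⊗[k] H) →ₗ[k] M ⊗[k] (M ⊗[k] M) :=
  (TensorProduct.assoc k M M M).toLinearMap.comp
    ((TensorProduct.comm k M (M ⊗[k] M)).toLinearMap.comp
      (LinearMap.lTensor M (TensorProduct.map (act.flip l) (act.flip m))))

@[simp]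
theorem actSwap₂_tmul (act : H →ₗ[k] M →ₗ[k] M) (l m n : M) (g h : H) :
    actSwap₂ act l m (n ⊗ₜ[k] (g ⊗ₜ[k] h)) = act g l ⊗ₜ[k] (act h m ⊗ₜ[k] n) := by
  simp [actSwap₂]

@[simp]
theorem phiOp3_tmul (act : H →ₗ[k] M →ₗ[k] M) (A B C : H) (l m n : M) :
    phiOp3 act A B C (l ⊗ₜ[k] (m ⊗ₜ[k] n)) = act A l ⊗ₜ[k] (act B m ⊗ₜ[k] act C n) := by
  simp [phiOp3]

theorem op12_tmul (R : M ⊗[k] M →ₗ[k] M ⊗[k] M) (l m n : M) :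
    op12 R (l ⊗ₜ[k] (m ⊗ₜ[k] n)) = TensorProduct.assoc k M M M (R (l ⊗ₜ[k] m) ⊗ₜ[k] n) := by
  simp [op12]

theorem op23_tmul (R : M ⊗[k] M →ₗ[k] M ⊗[k] M) (l m n : M) :
    op23 R (l ⊗ₜ[k] (m ⊗ₜ[k] n)) = l ⊗ₜ[k] R (m ⊗ₜ[k] n) := by
  simp [op23]

theorem op13_tmul (R : M ⊗[k] M →ₗ[k] M ⊗[k] M) (l m n : M) :
    op13 R (l ⊗ₜ[k] (m ⊗ₜ[k] n)) =
      swap23 (TensorProduct.assoc k M M M (R (l ⊗ₜ[k] n) ⊗ₜ[k] m)) := by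
  simp [op13, op12, swap23]

theorem leftComm_op13 (R : M ⊗[k] M →ₗ[k] M ⊗[k] M) (t : M ⊗[k] (M ⊗[k] M)) :
    TensorProduct.leftComm k M M M (op13 R t) = op23 R (TensorProduct.leftComm k M M M t) := by
  suffices h : (TensorProduct.leftComm k M M M).toLinearMap.comp (op13 R) =
      (op23 R).comp (TensorProduct.leftComm k M M M).toLinearMap from LinearMap.congr_fun h t
  ext l m n
  simp only [TensorProduct.AlgebraTensorModule.curry_apply, TensorProduct.curry_apply,
    LinearMap.coe_restrictScalars, LinearMap.comp_apply, LinearEquiv.coe_coe, op13_tmul,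
    TensorProduct.leftComm_tmul, op23_tmul]
  induction R (l ⊗ₜ[k] n) using TensorProduct.induction_on with
  | zero => simp
  | tmul p q => simp [swap23]
  | add a b ha hb => simp only [map_add, TensorProduct.tmul_add, TensorProduct.add_tmul, ha, hb]

theorem leftComm_op23 (R : M ⊗[k] M →ₗ[k] M ⊗[k] M) (t : M ⊗[k] (M ⊗[k] M)) :
    TensorProduct.leftComm k M M M (op23 R t) = op13 R (TensorProduct.leftComm k M M M t) := by
  obtain ⟨s, rfl⟩ := (TensorProduct.leftComm k M M M).surjective t
  have inv (u : M ⊗[k] (M ⊗[k] M)) :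
      TensorProduct.leftComm k M M M (TensorProduct.leftComm k M M M u) = u :=
    (TensorProduct.leftComm k M M M).symm_apply_apply u
  rw [← leftComm_op13, inv, inv]

theorem leftComm_phiOp3 (act : H →ₗ[k] M →ₗ[k] M) (A B C : H) (t : M ⊗[k] (M ⊗[k] M)) :
    TensorProduct.leftComm k M M M (phiOp3 act A B C t) =
      phiOp3 act B A C (TensorProduct.leftComm k M M M t) := by
  suffices h : (TensorProduct.leftComm k M M M).toLinearMap.comp (phiOp3 act A B C) =
      (phiOp3 act B A C).comp (TensorProduct.leftComm k M M M).toLinearMap from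
    LinearMap.congr_fun h t
  ext l m n
  simp

/-- The operator `l ⊗ m ⊗ n ↦ ∑ n₍₁₎₁·l ⊗ n₍₁₎₂·m ⊗ n₍₀₎` on `M ⊗ M ⊗ M`, the action of
`(Δ ⊗ id)(R)`. -/
def coproductR (Q : QuasiBialgebra k H) (act : H →ₗ[k] M →ₗ[k] M)
    (coact : M →ₗ[k] M ⊗[k] H) : M ⊗[k] (M ⊗[k] M) →ₗ[k] M ⊗[k] (M ⊗[k] M) :=
  (TensorProduct.lift (TensorProduct.lift
    (LinearMap.mk₂ k
      (fun l m => (actSwap₂ act l m).comp ((LinearMap.lTensor M Q.Δmap.toLinearMap).comp coact))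
      (fun l l' m => by
        simp [actSwap₂, TensorProduct.map_add_left, LinearMap.lTensor_add, LinearMap.add_comp,
          LinearMap.comp_add])
      (fun c l m => by
        simp [actSwap₂, TensorProduct.map_smul_left, LinearMap.lTensor_smul, LinearMap.smul_comp,
          LinearMap.comp_smul])
      (fun l m m' => by
        simp [actSwap₂, TensorProduct.map_add_right, LinearMap.lTensor_add, LinearMap.add_comp,
          LinearMap.comp_add])
      (fun c l m => by
        simp [actSwap₂, TensorProduct.map_smul_right, LinearMap.lTensor_smul,
          LinearMap.smul_comp, LinearMap.comp_smul])))).comp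
    (TensorProduct.assoc k M M M).symm.toLinearMap

theorem coproductR_tmul (Q : QuasiBialgebra k H) (act : H →ₗ[k] M →ₗ[k] M)
    (coact : M →ₗ[k] M ⊗[k] H) (l m n : M) :
    coproductR Q act coact (l ⊗ₜ[k] (m ⊗ₜ[k] n)) =
      actSwap₂ act l m (LinearMap.lTensor M Q.Δmap.toLinearMap (coact n)) :=
  rfl

namespace IsLeftRightYD

variable {Q : QuasiBialgebra k H} {act : H →ₗ[k] M →ₗ[k] M} {coact : M →ₗ[k] M ⊗[k] H}

theorem mul_act_apply (hM : IsLeftRightYD Q act coact) (g h : H) (m : M) :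
    act (g * h) m = act g (act h m) := by
  rw [hM.mul_act, LinearMap.comp_apply]

theorem phi_left_inv_apply (hM : IsLeftRightYD Q act coact) (t : M ⊗[k] (M ⊗[k] M)) :
    ∑ a, phiOp3 act (Q.x1 a) (Q.x2 a) (Q.x3 a)
      (∑ i, phiOp3 act (Q.X1 i) (Q.X2 i) (Q.X3 i) t) = t := by
  suffices h : (∑ a, phiOp3 act (Q.x1 a) (Q.x2 a) (Q.x3 a)).comp
      (∑ i, phiOp3 act (Q.X1 i) (Q.X2 i) (Q.X3 i)) = LinearMap.id by
    simpa using LinearMap.congr_fun h t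
  ext l m n
  have h := congrArg (TensorProduct.map (act.flip l)
    (TensorProduct.map (act.flip m) (act.flip n))) Q.Φ_left_inv
  simpa [Finset.sum_mul_sum, Algebra.TensorProduct.one_def, hM.mul_act_apply, hM.one_act,
    Finset.sum_comm (s := (Finset.univ : Finset Q.I))] using h

theorem phi312_right_inv_apply (hM : IsLeftRightYD Q act coact) (t : M ⊗[k] (M ⊗[k] M)) :
    ∑ i, phiOp3 act (Q.X2 i) (Q.X3 i) (Q.X1 i)
      (∑ a, phiOp3 act (Q.x2 a) (Q.x3 a) (Q.x1 a) t) = t := by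
  suffices h : (∑ i, phiOp3 act (Q.X2 i) (Q.X3 i) (Q.X1 i)).comp
      (∑ a, phiOp3 act (Q.x2 a) (Q.x3 a) (Q.x1 a)) = LinearMap.id by
    simpa using LinearMap.congr_fun h t
  ext l m n
  have h := congrArg ((TensorProduct.assoc k M M M).toLinearMap.comp
    ((TensorProduct.comm k M (M ⊗[k] M)).toLinearMap.comp (TensorProduct.map (act.flip n)
    (TensorProduct.map (act.flip l) (act.flip m))))) Q.Φ_right_inv
  simpa [Finset.sum_mul_sum, Algebra.TensorProduct.one_def, hM.mul_act_apply, hM.one_act,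
    Finset.sum_comm (s := (Finset.univ : Finset Q.I'))] using h

theorem op13_phi_op23_tmul (hM : IsLeftRightYD Q act coact) (A B C : H) (l m n : M) :
    op13 (ydR act coact) (phiOp3 act A C B (op23 (ydR act coact) (l ⊗ₜ[k] (m ⊗ₜ[k] n)))) =
      actSwap₂ act l m (TensorProduct.assoc k M H H
        ((TensorProduct.map (LinearMap.lTensor M (LinearMap.mulRight k A))
          (LinearMap.mulLeft k C))
          ((LinearMap.rTensor H (coact.comp (act B))) (coact n)))) := by
  rw [op23_tmul, ydR_tmul]
  induction coact n using TensorProduct.induction_on with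
  | zero => simp
  | add a b ha hb => simp only [map_add, TensorProduct.tmul_add, ha, hb]
  | tmul p h =>
    simp only [actSwap_tmul, phiOp3_tmul, op13_tmul, ydR_tmul, LinearMap.rTensor_tmul,
      LinearMap.comp_apply, TensorProduct.map_tmul]
    induction coact (act B p) using TensorProduct.induction_on with
    | zero => simp
    | add a b ha hb => simp only [map_add, TensorProduct.add_tmul, ha, hb]
    | tmul q g => simp [swap23, hM.mul_act_apply]

theorem actSwap₂_map_lrH (hM : IsLeftRightYD Q act coact) (A B C A' B' : H) (l m : M)
    (t : M ⊗[k] (H ⊗[k] H)) :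
    actSwap₂ act l m ((TensorProduct.map (act A)
        (TensorProduct.map (lrH k B A') (lrH k C B'))) t) =
      phiOp3 act B C A (actSwap₂ act (act A' l) (act B' m) t) := by
  suffices h : (actSwap₂ act l m).comp (TensorProduct.map (act A)
      (TensorProduct.map (lrH k B A') (lrH k C B'))) =
      (phiOp3 act B C A).comp (actSwap₂ act (act A' l) (act B' m)) from LinearMap.congr_fun h t
  ext n g h
  simp [lrH, hM.mul_act_apply]

/-- Axiom `lry1` as an identity of operators on `M ⊗ M ⊗ M`. -/
theorem sum_op13_phi_op23 (hM : IsLeftRightYD Q act coact) (t : M ⊗[k] (M ⊗[k] M)) :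
    ∑ a, op13 (ydR act coact) (phiOp3 act (Q.x1 a) (Q.x3 a) (Q.x2 a)
        (op23 (ydR act coact) t)) =
      ∑ a, phiOp3 act (Q.x2 a) (Q.x3 a) (Q.x1 a) (coproductR Q act coact
        (∑ b, phiOp3 act (Q.x1 b) (Q.x2 b) (Q.x3 b) t)) := by
  suffices h : ∑ a, (op13 (ydR act coact)).comp ((phiOp3 act (Q.x1 a) (Q.x3 a) (Q.x2 a)).comp
        (op23 (ydR act coact))) =
      ∑ a, (phiOp3 act (Q.x2 a) (Q.x3 a) (Q.x1 a)).comp ((coproductR Q act coact).comp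
        (∑ b, phiOp3 act (Q.x1 b) (Q.x2 b) (Q.x3 b))) by
    simpa using LinearMap.congr_fun h t
  ext l m n
  have h := congrArg (fun s => actSwap₂ act l m (TensorProduct.assoc k M H H s)) (hM.lry1 n)
  simp only [map_sum, LinearEquiv.apply_symm_apply, ← hM.op13_phi_op23_tmul,
    hM.actSwap₂_map_lrH] at h
  simpa [coproductR_tmul] using h

/-- The hexagon identity `Φ₃₁₂ R₁₃ Φ⁻¹₁₃₂ R₂₃ Φ = (Δ ⊗ id)(R)`. -/
theorem hexagon (hM : IsLeftRightYD Q act coact) (t : M ⊗[k] (M ⊗[k] M)) :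
    ∑ i, phiOp3 act (Q.X2 i) (Q.X3 i) (Q.X1 i) (op13 (ydR act coact)
      (∑ a, phiOp3 act (Q.x1 a) (Q.x3 a) (Q.x2 a) (op23 (ydR act coact)
        (∑ i, phiOp3 act (Q.X1 i) (Q.X2 i) (Q.X3 i) t)))) = coproductR Q act coact t := by
  simp only [map_sum (op13 (ydR act coact))]
  rw [hM.sum_op13_phi_op23, hM.phi_left_inv_apply, hM.phi312_right_inv_apply]

/-- The hexagon identity with its first two tensor factors exchanged. -/
theorem hexagon_leftComm (hM : IsLeftRightYD Q act coact) (t : M ⊗[k] (M ⊗[k] M)) :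
    ∑ i, phiOp3 act (Q.X3 i) (Q.X2 i) (Q.X1 i) (op23 (ydR act coact)
      (∑ a, phiOp3 act (Q.x3 a) (Q.x1 a) (Q.x2 a) (op13 (ydR act coact)
        (∑ i, phiOp3 act (Q.X2 i) (Q.X1 i) (Q.X3 i) t)))) =
      TensorProduct.leftComm k M M M
        (coproductR Q act coact (TensorProduct.leftComm k M M M t)) := by
  obtain ⟨s, rfl⟩ := (TensorProduct.leftComm k M M M).surjective t
  have inv : TensorProduct.leftComm k M M M (TensorProduct.leftComm k M M M s) = s :=
    (TensorProduct.leftComm k M M M).symm_apply_apply s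
  rw [inv, ← hM.hexagon]
  simp only [map_sum (TensorProduct.leftComm k M M M), leftComm_phiOp3, leftComm_op13,
    leftComm_op23]

theorem actSwap_map (hM : IsLeftRightYD Q act coact) (A B : H) (l : M) (t : M ⊗[k] H) :
    actSwap act l (TensorProduct.map (act A) (LinearMap.mulLeft k B) t) =
      TensorProduct.map (act B) (act A) (actSwap act l t) := by
  suffices h : (actSwap act l).comp (TensorProduct.map (act A) (LinearMap.mulLeft k B)) =
      (TensorProduct.map (act B) (act A)).comp (actSwap act l) from LinearMap.congr_fun h t
  ext n h
  simp [hM.mul_act_apply]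

theorem actSwap_lTensor_mulRight (hM : IsLeftRightYD Q act coact) (A : H) (l : M)
    (t : M ⊗[k] H) :
    actSwap act l (LinearMap.lTensor M (LinearMap.mulRight k A) t) =
      actSwap act (act A l) t := by
  suffices h : (actSwap act l).comp (LinearMap.lTensor M (LinearMap.mulRight k A)) =
      actSwap act (act A l) from LinearMap.congr_fun h t
  ext n h
  simp [hM.mul_act_apply]

/-- `R` intertwines `Δ` with the opposite coproduct. -/
theorem ydR_comul (hM : IsLeftRightYD Q act coact) (h : H) (l m : M) :
    ∑ j, ydR act coact (act (Q.Δ1 h j) l ⊗ₜ[k] act (Q.Δ2 h j) m) =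
      ∑ j, TensorProduct.map (act (Q.Δ2 h j)) (act (Q.Δ1 h j))
        (ydR act coact (l ⊗ₜ[k] m)) := by
  have h := congrArg (actSwap act l) (hM.lry3 h m)
  simpa [hM.actSwap_map, hM.actSwap_lTensor_mulRight, ydR_tmul] using h.symm

theorem op12_coproductR (hM : IsLeftRightYD Q act coact) (t : M ⊗[k] (M ⊗[k] M)) :
    op12 (ydR act coact) (coproductR Q act coact t) =
      TensorProduct.leftComm k M M M (coproductR Q act coact
        (TensorProduct.leftComm k M M M (op12 (ydR act coact) t))) := by
  suffices h : (op12 (ydR act coact)).comp (coproductR Q act coact) =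
      (TensorProduct.leftComm k M M M).toLinearMap.comp ((coproductR Q act coact).comp
        ((TensorProduct.leftComm k M M M).toLinearMap.comp (op12 (ydR act coact)))) from
    LinearMap.congr_fun h t
  ext l m n
  simp only [TensorProduct.AlgebraTensorModule.curry_apply, TensorProduct.curry_apply,
    LinearMap.coe_restrictScalars, LinearMap.comp_apply, LinearEquiv.coe_coe, coproductR_tmul,
    op12_tmul]
  obtain ⟨S, hS⟩ := TensorProduct.exists_finset (coact n)
  have key (s : M ⊗[k] M) : TensorProduct.leftComm k M M M (coproductR Q act coact
        (TensorProduct.leftComm k M M M (TensorProduct.assoc k M M M (s ⊗ₜ[k] n)))) =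
      ∑ x ∈ S, ∑ j, TensorProduct.assoc k M M M
        (TensorProduct.map (act (Q.Δ2 x.2 j)) (act (Q.Δ1 x.2 j)) s ⊗ₜ[k] x.1) := by
    induction s using TensorProduct.induction_on with
    | zero => simp
    | add a b ha hb =>
      simp only [map_add, TensorProduct.add_tmul, Finset.sum_add_distrib, ha, hb]
    | tmul p q => simp [coproductR_tmul, hS, Q.Δ_eq, TensorProduct.tmul_sum]
  rw [key, hS]
  simp only [map_sum, LinearMap.lTensor_tmul, AlgHom.toLinearMap_apply, Q.Δ_eq,
    TensorProduct.tmul_sum, actSwap₂_tmul, op12_tmul]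
  refine Finset.sum_congr rfl fun x _ => ?_
  rw [← map_sum, ← TensorProduct.sum_tmul, hM.ydR_comul, TensorProduct.sum_tmul, map_sum]

end IsLeftRightYD

end

/-- The map `R_M(m⊗n) = ∑ n₍₁₎·m ⊗ n₍₀₎` of a left-right Yetter-Drinfeld module
over a quasi-bialgebra satisfies the quasi-Yang-Baxter equation
`R₁₂ Φ₃₁₂ R₁₃ Φ⁻¹₁₃₂ R₂₃ Φ = Φ₃₂₁ R₂₃ Φ⁻¹₂₃₁ R₁₃ Φ₂₁₃ R₁₂`
on `End(M⊗M⊗M)`. -/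
theorem quasi_yang_baxter {k H : Type} [Field k] [Ring H] [Algebra k H]
    (Q : QuasiBialgebra k H) {M : Type} [AddCommGroup M] [Module k M]
    (act : H →ₗ[k] M →ₗ[k] M) (coact : M →ₗ[k] M ⊗[k] H)
    (hM : IsLeftRightYD Q act coact) :
    (op12 (ydR act coact)).comp
      ((∑ i, phiOp3 act (Q.X2 i) (Q.X3 i) (Q.X1 i)).comp
        ((op13 (ydR act coact)).comp
          ((∑ a, phiOp3 act (Q.x1 a) (Q.x3 a) (Q.x2 a)).comp
            ((op23 (ydR act coact)).comp
              (∑ i, phiOp3 act (Q.X1 i) (Q.X2 i) (Q.X3 i))))))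
    = (∑ i, phiOp3 act (Q.X3 i) (Q.X2 i) (Q.X1 i)).comp
        ((op23 (ydR act coact)).comp
          ((∑ a, phiOp3 act (Q.x3 a) (Q.x1 a) (Q.x2 a)).comp
            ((op13 (ydR act coact)).comp
              ((∑ i, phiOp3 act (Q.X2 i) (Q.X1 i) (Q.X3 i)).comp
                (op12 (ydR act coact)))))) := by
  refine LinearMap.ext fun t => ?_
  simp only [LinearMap.comp_apply, LinearMap.sum_apply]
  rw [hM.hexagon, hM.hexagon_leftComm, hM.op12_coproductR]
end
end

section
/- Let H be a quasi-bialgebra over a field k and let M be a finite-dimensional right-left Yetter–Drinfeld module over H. Then the dual space M*, with left H-action (h·m*)(m) = m*(m·h) and with right H-coaction M*→M*⊗H, m*↦∑m*_(0)⊗m*_(1), uniquely determined by ∑m*_(0)(m) m*_(1) = ∑m*(m_(0)) m_(-1) for all m∈M, is a left-right Yetter–Drinfeld module over H. -/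
open scoped TensorProduct

noncomputable section
section

variable {k H : Type} [Field k] [Ring H] [Algebra k H]
variable {M : Type} [AddCommGroup M] [Module k M]

/-- A right-left Yetter-Drinfeld module over a quasi-bialgebra `Q`: a right
`H`-module (with `act h m = m·h`) together with a left `H`-coaction
`coact : M →ₗ H ⊗ M`, `m ↦ ∑ m₍₋₁₎ ⊗ m₍₀₎`, satisfying the axioms
(rly1), (rly2), (rly3). -/
structure IsRightLeftYD (Q : QuasiBialgebra k H)
    (act : H →ₗ[k] M →ₗ[k] M) (coact : M →ₗ[k] H ⊗[k] M) : Prop where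
  one_act : act 1 = LinearMap.id
  mul_act : ∀ g h, act (g * h) = (act h).comp (act g)
  /-- `∑ m₍₋₁₎x¹ ⊗ x³(m₍₀₎·x²)₍₋₁₎ ⊗ (m₍₀₎·x²)₍₀₎
      = ∑ y²(m·y¹)₍₋₁₎₁x¹ ⊗ y³(m·y¹)₍₋₁₎₂x² ⊗ (m·y¹)₍₀₎·x³` -/
  rly1 : ∀ m,
    ∑ a, (TensorProduct.map (LinearMap.mulRight k (Q.x1 a))
        (LinearMap.rTensor M (LinearMap.mulLeft k (Q.x3 a))))
        ((LinearMap.lTensor H (coact.comp (act (Q.x2 a)))) (coact m))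
    = ∑ a, ∑ a2, (TensorProduct.assoc k H H M)
        ((TensorProduct.map
          (TensorProduct.map (lrH k (Q.x2 a2) (Q.x1 a)) (lrH k (Q.x3 a2) (Q.x2 a)))
          (act (Q.x3 a)))
          ((LinearMap.rTensor M Q.Δmap.toLinearMap) (coact (act (Q.x1 a2) m))))
  /-- `∑ ε(m₍₋₁₎) m₍₀₎ = m` -/
  rly2 : ∀ m,
    (TensorProduct.lid k M) ((LinearMap.rTensor M Q.ε.toLinearMap) (coact m)) = m
  /-- `∑ m₍₋₁₎h₁ ⊗ m₍₀₎·h₂ = ∑ h₂(m·h₁)₍₋₁₎ ⊗ (m·h₁)₍₀₎` -/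
  rly3 : ∀ h m,
    ∑ j, (TensorProduct.map (LinearMap.mulRight k (Q.Δ1 h j)) (act (Q.Δ2 h j))) (coact m)
    = ∑ j, (LinearMap.rTensor M (LinearMap.mulLeft k (Q.Δ2 h j)))
        (coact (act (Q.Δ1 h j) m))

/-- The left `H`-action `(h·m*)(m) = m*(m·h)` on the dual of a right module. -/
def dualAct (act : H →ₗ[k] M →ₗ[k] M) :
    H →ₗ[k] Module.Dual k M →ₗ[k] Module.Dual k M :=
  ((LinearMap.llcomp k M M k).flip).comp act

/-- Evaluating the first tensor factor of an element of `M* ⊗ H` at `m ∈ M`. -/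
def evalFirst (m : M) : (Module.Dual k M) ⊗[k] H →ₗ[k] H :=
  TensorProduct.lift ((LinearMap.lsmul k H).comp (Module.Dual.eval k M m))

/-- The map `R_M(m⊗n) = ∑ m·n₍₋₁₎ ⊗ n₍₀₎` of a right-left Yetter-Drinfeld
module. -/
def ydRrl (act : H →ₗ[k] M →ₗ[k] M) (coact : M →ₗ[k] H ⊗[k] M) :
    M ⊗[k] M →ₗ[k] M ⊗[k] M :=
  (LinearMap.rTensor M (TensorProduct.lift act.flip)).comp
    ((TensorProduct.assoc k M H M).symm.toLinearMap.comp (LinearMap.lTensor M coact))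

end

section

variable {k H : Type} [Field k] [Ring H] [Algebra k H]
variable {M : Type} [AddCommGroup M] [Module k M]
variable {W : Type} [AddCommGroup W] [Module k W]

theorem dualAct_apply (act : H →ₗ[k] M →ₗ[k] M) (h : H) (φ : Module.Dual k M) :
    dualAct act h φ = φ.comp (act h) := rfl

theorem evalFirst_tmul (m : M) (φ : Module.Dual k M) (h : H) :
    evalFirst m (φ ⊗ₜ[k] h) = φ m • h := rfl

/-- Two elements of `M* ⊗ W` agree as soon as all their evaluations at points of `M` agree. -/
theorem dualTensorHom_ext [Module.Finite k M] {s t : Module.Dual k M ⊗[k] W}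
    (h : ∀ m, dualTensorHom k M W s m = dualTensorHom k M W t m) : s = t := by
  refine (dualTensorHomEquiv k M W).injective ?_
  ext m
  simpa using h m

theorem dualTensorHom_eq_evalFirst (t : Module.Dual k M ⊗[k] H) (m : M) :
    dualTensorHom k M H t m = evalFirst m t := by
  induction t with
  | zero => simp
  | add s t hs ht => simp [hs, ht]
  | tmul φ h => simp [evalFirst_tmul]

theorem dualTensorHom_assoc (t : (Module.Dual k M ⊗[k] H) ⊗[k] H) (m : M) :
    dualTensorHom k M (H ⊗[k] H) (TensorProduct.assoc k _ H H t) m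
      = LinearMap.rTensor H (evalFirst m) t := by
  induction t with
  | zero => simp
  | add s t hs ht => simp [hs, ht]
  | tmul t g =>
    induction t with
    | zero => simp
    | add s t hs ht => simp only [TensorProduct.add_tmul, map_add, LinearMap.add_apply, hs, ht]
    | tmul φ h => simp [evalFirst_tmul, TensorProduct.smul_tmul']

/-- The contraction `w ⊗ m ↦ φ(m) w`. -/
def contractLast (W : Type) [AddCommGroup W] [Module k W] (φ : Module.Dual k M) :
    W ⊗[k] M →ₗ[k] W :=
  (TensorProduct.rid k W).toLinearMap.comp (LinearMap.lTensor W φ)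

theorem contractLast_tmul (φ : Module.Dual k M) (w : W) (m : M) :
    contractLast W φ (w ⊗ₜ[k] m) = φ m • w := by
  simp [contractLast]

theorem contractLast_map {W' : Type} [AddCommGroup W'] [Module k W']
    (φ : Module.Dual k M) (f : W →ₗ[k] W') (g : M →ₗ[k] M) (u : W ⊗[k] M) :
    contractLast W' φ (TensorProduct.map f g u) = f (contractLast W (φ.comp g) u) := by
  induction u with
  | zero => simp
  | add s t hs ht => simp [hs, ht]
  | tmul w m => simp [contractLast_tmul]

theorem contractLast_rTensor {W' : Type} [AddCommGroup W'] [Module k W']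
    (φ : Module.Dual k M) (f : W →ₗ[k] W') (u : W ⊗[k] M) :
    contractLast W' φ (LinearMap.rTensor M f u) = f (contractLast W φ u) :=
  contractLast_map φ f LinearMap.id u

theorem contractLast_assoc (φ : Module.Dual k M) (u : (H ⊗[k] H) ⊗[k] M) :
    LinearMap.lTensor H (contractLast H φ) (TensorProduct.assoc k H H M u)
      = contractLast (H ⊗[k] H) φ u := by
  induction u with
  | zero => simp
  | add s t hs ht => simp [hs, ht]
  | tmul w m =>
    induction w with
    | zero => simp
    | add s t hs ht => simp only [TensorProduct.add_tmul, map_add, hs, ht]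
    | tmul g h => simp [contractLast_tmul]

theorem dualTensorHom_map (act : H →ₗ[k] M →ₗ[k] M) {W' : Type} [AddCommGroup W'] [Module k W']
    (h : H) (f : W →ₗ[k] W') (t : Module.Dual k M ⊗[k] W) (m : M) :
    dualTensorHom k M W' (TensorProduct.map (dualAct act h) f t) m
      = f (dualTensorHom k M W t (act h m)) := by
  induction t with
  | zero => simp
  | add s t hs ht => simp [hs, ht]
  | tmul φ w => simp [dualAct_apply]

theorem dualTensorHom_lTensor {W' : Type} [AddCommGroup W'] [Module k W']
    (f : W →ₗ[k] W') (t : Module.Dual k M ⊗[k] W) (m : M) :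
    dualTensorHom k M W' (LinearMap.lTensor _ f t) m = f (dualTensorHom k M W t m) := by
  induction t with
  | zero => simp
  | add s t hs ht => simp [hs, ht]
  | tmul φ w => simp

/-- Coacting twice on the dual and evaluating is contracting a double coaction on `M`. -/
theorem rTensor_evalFirst_coact_coact
    (act : H →ₗ[k] M →ₗ[k] M) (coact : M →ₗ[k] H ⊗[k] M)
    (coactD : Module.Dual k M →ₗ[k] Module.Dual k M ⊗[k] H)
    (hdet : ∀ φ m, dualTensorHom k M H (coactD φ) m = contractLast H φ (coact m))
    (a b c : H) (φ : Module.Dual k M) (m : M) :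
    LinearMap.rTensor H (evalFirst m)
      (TensorProduct.map (LinearMap.lTensor _ (LinearMap.mulRight k a)) (LinearMap.mulLeft k c)
        (LinearMap.rTensor H (coactD.comp (dualAct act b)) (coactD φ)))
    = LinearMap.lTensor H (contractLast H φ)
        (TensorProduct.map (LinearMap.mulRight k a) (LinearMap.rTensor M (LinearMap.mulLeft k c))
          (LinearMap.lTensor H (coact.comp (act b)) (coact m))) := by
  have inner : ∀ t : Module.Dual k M ⊗[k] H,
      LinearMap.rTensor H (evalFirst m)
        (TensorProduct.map (LinearMap.lTensor _ (LinearMap.mulRight k a)) (LinearMap.mulLeft k c)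
          (LinearMap.rTensor H (coactD.comp (dualAct act b)) t))
      = TensorProduct.map (LinearMap.mulRight k a)
          ((LinearMap.mulLeft k c).comp ((dualTensorHom k M H t).comp (act b))) (coact m) := by
    intro t
    induction t with
    | zero => simp [LinearMap.comp_zero, LinearMap.zero_comp, TensorProduct.map_zero_right]
    | add s t hs ht =>
      simp only [map_add, hs, ht, LinearMap.add_comp, LinearMap.comp_add,
        TensorProduct.map_add_right, LinearMap.add_apply]
    | tmul ψ h =>
      simp only [LinearMap.rTensor_tmul, TensorProduct.map_tmul, LinearMap.comp_apply,
        ← dualTensorHom_eq_evalFirst, dualTensorHom_lTensor, hdet]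
      generalize coact m = u
      induction u with
      | zero => simp
      | add s t hs ht => simp only [map_add, TensorProduct.add_tmul, hs, ht]
      | tmul g n =>
        simp [contractLast_tmul, dualAct_apply, TensorProduct.smul_tmul]
  rw [inner]
  generalize coact m = u
  induction u with
  | zero => simp
  | add s t hs ht => simp only [map_add, hs, ht]
  | tmul g n =>
    simp [hdet, contractLast_rTensor]

end

/-- The dual of a finite-dimensional right-left Yetter-Drinfeld module `M` over a
quasi-bialgebra, with left action `(h·m*)(m) = m*(m·h)` and right coaction
determined by `∑ m*₍₀₎(m) m*₍₁₎ = ∑ m*(m₍₀₎) m₍₋₁₎`, is a left-right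
Yetter-Drinfeld module. -/
theorem dual_isLeftRightYD {k H : Type} [Field k] [Ring H] [Algebra k H]
    (Q : QuasiBialgebra k H) {M : Type} [AddCommGroup M] [Module k M]
    [Module.Finite k M]
    (act : H →ₗ[k] M →ₗ[k] M) (coact : M →ₗ[k] H ⊗[k] M)
    (hM : IsRightLeftYD Q act coact)
    (coactD : Module.Dual k M →ₗ[k] (Module.Dual k M) ⊗[k] H)
    (hdet : ∀ (φ : Module.Dual k M) (m : M),
      evalFirst m (coactD φ)
        = (TensorProduct.rid k H) ((LinearMap.lTensor H φ) (coact m))) :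
    IsLeftRightYD Q (dualAct act) coactD := by
  have hev : ∀ φ m, dualTensorHom k M H (coactD φ) m = contractLast H φ (coact m) :=
    fun φ m => (dualTensorHom_eq_evalFirst _ m).trans (hdet φ m)
  refine ⟨?_, fun g h => ?_, fun φ => ?_, fun φ => ?_, fun h φ => ?_⟩
  · ext φ m
    simp [dualAct_apply, hM.one_act]
  · ext φ m
    simp [dualAct_apply, hM.mul_act]
  · apply (TensorProduct.assoc k _ H H).injective
    refine dualTensorHom_ext fun m => ?_
    have key := congrArg (LinearMap.lTensor H (contractLast H φ)) (hM.rly1 m)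
    rw [dualTensorHom_assoc]
    simp only [map_sum, LinearMap.sum_apply, LinearEquiv.apply_symm_apply,
      rTensor_evalFirst_coact_coact act coact coactD hev] at key ⊢
    rw [key, Finset.sum_comm]
    refine Finset.sum_congr rfl fun a _ => Finset.sum_congr rfl fun b _ => ?_
    rw [dualTensorHom_map, dualTensorHom_lTensor, hev, contractLast_assoc, contractLast_map,
      contractLast_rTensor, dualAct_apply]
  · ext m
    have hrid : ∀ t : Module.Dual k M ⊗[k] H,
        TensorProduct.rid k _ (LinearMap.lTensor _ Q.ε.toLinearMap t) m
          = Q.ε (dualTensorHom k M H t m) := by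
      intro t
      induction t with
      | zero => simp
      | add s t hs ht => simp only [map_add, LinearMap.add_apply, hs, ht]
      | tmul ψ h => simp [mul_comm]
    have hlid : ∀ u : H ⊗[k] M,
        Q.ε (contractLast H φ u)
          = φ (TensorProduct.lid k M (LinearMap.rTensor M Q.ε.toLinearMap u)) := by
      intro u
      induction u with
      | zero => simp
      | add s t hs ht => simp only [map_add, hs, ht]
      | tmul h n => simp [contractLast_tmul, mul_comm]
    rw [hrid, hev, hlid, hM.rly2]
  · refine dualTensorHom_ext fun m => ?_
    have key := congrArg (contractLast H φ) (hM.rly3 h m)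
    simp only [map_sum, LinearMap.sum_apply, dualTensorHom_map, dualTensorHom_lTensor, hev,
      contractLast_map, contractLast_rTensor, dualAct_apply] at key ⊢
    exact key.symm
end
end

section
/- Let H be a quasi-bialgebra over a field k and M a finite-dimensional right-left Yetter–Drinfeld module over H, with dual left-right Yetter–Drinfeld module M*. Under the canonical identification (M⊗M)* ≅ M*⊗M*, the map R_{M*} : M*⊗M* → M*⊗M*, R_{M*}(m*⊗n*) = ∑ n*_(1)·m* ⊗ n*_(0), equals the transpose (R_M)* of the map R_M : M⊗M → M⊗M, R_M(m⊗n) = ∑ m·n_(-1) ⊗ n_(0). -/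
open scoped TensorProduct

noncomputable section
section

variable {k H : Type} [Field k] [Ring H] [Algebra k H]
variable {M : Type} [AddCommGroup M] [Module k M]

theorem dualDistrib_ydR_dualAct_apply (act : H →ₗ[k] M →ₗ[k] M)
    (coactD : Module.Dual k M →ₗ[k] (Module.Dual k M) ⊗[k] H)
    (φ ψ : Module.Dual k M) (m n : M) :
    TensorProduct.dualDistrib k M M (ydR (dualAct act) coactD (φ ⊗ₜ[k] ψ)) (m ⊗ₜ[k] n)
      = φ (act (evalFirst n (coactD ψ)) m) := by
  simp only [ydR, LinearMap.comp_apply, LinearMap.lTensor_tmul, LinearEquiv.coe_coe]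
  induction coactD ψ using TensorProduct.induction_on with
  | zero => simp
  | tmul χ h => simp [evalFirst, dualAct, mul_comm]
  | add x y hx hy => simp only [map_add, TensorProduct.tmul_add, LinearMap.add_apply, hx, hy]

theorem dualDistrib_ydRrl_apply (act : H →ₗ[k] M →ₗ[k] M) (coact : M →ₗ[k] H ⊗[k] M)
    (φ ψ : Module.Dual k M) (m n : M) :
    TensorProduct.dualDistrib k M M (φ ⊗ₜ[k] ψ) (ydRrl act coact (m ⊗ₜ[k] n))
      = φ (act (TensorProduct.rid k H (LinearMap.lTensor H ψ (coact n))) m) := by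
  simp only [ydRrl, LinearMap.comp_apply, LinearMap.lTensor_tmul, LinearEquiv.coe_coe]
  induction coact n using TensorProduct.induction_on with
  | zero => simp
  | tmul h p => simp [mul_comm]
  | add x y hx hy => simp only [map_add, TensorProduct.tmul_add, LinearMap.add_apply, hx, hy]

end

/-- Under the canonical identification `(M⊗M)* ≅ M*⊗M*`, the map
`R_{M*}(m*⊗n*) = ∑ n*₍₁₎·m* ⊗ n*₍₀₎` of the dual left-right Yetter-Drinfeld
module coincides with the transpose of `R_M(m⊗n) = ∑ m·n₍₋₁₎ ⊗ n₍₀₎`. -/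
theorem dual_ydR_eq_transpose {k H : Type} [Field k] [Ring H] [Algebra k H]
    (Q : QuasiBialgebra k H) {M : Type} [AddCommGroup M] [Module k M]
    [Module.Finite k M]
    (act : H →ₗ[k] M →ₗ[k] M) (coact : M →ₗ[k] H ⊗[k] M)
    (hM : IsRightLeftYD Q act coact)
    (coactD : Module.Dual k M →ₗ[k] (Module.Dual k M) ⊗[k] H)
    (hdet : ∀ (φ : Module.Dual k M) (m : M),
      evalFirst m (coactD φ)
        = (TensorProduct.rid k H) ((LinearMap.lTensor H φ) (coact m))) :
    (TensorProduct.dualDistrib k M M).comp (ydR (dualAct act) coactD)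
      = (LinearMap.dualMap (ydRrl act coact)).comp (TensorProduct.dualDistrib k M M) := by
  ext φ ψ m n
  change TensorProduct.dualDistrib k M M (ydR (dualAct act) coactD (φ ⊗ₜ[k] ψ)) (m ⊗ₜ[k] n)
    = TensorProduct.dualDistrib k M M (φ ⊗ₜ[k] ψ) (ydRrl act coact (m ⊗ₜ[k] n))
  rw [dualDistrib_ydR_dualAct_apply, hdet, dualDistrib_ydRrl_apply]
end
end

section
/- Let H be a quasi-Hopf algebra over a field k, and set q_R = ∑q¹⊗q² = ∑X¹⊗S⁻¹(αX³)X². Then ∑ q¹y¹ ⊗ S(q²y²)y³ = 1⊗α, where Φ⁻¹ = ∑y¹⊗y²⊗y³. -/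
open scoped TensorProduct

noncomputable section

/-- A quasi-Hopf algebra: a quasi-bialgebra together with a bijective algebra
anti-automorphism `S` (with inverse `Sinv`) and elements `α, β` satisfying the
antipode axioms. -/
structure QuasiHopf (k H : Type) [Field k] [Ring H] [Algebra k H] extends
    QuasiBialgebra k H where
  S : H →ₗ[k] H
  Sinv : H →ₗ[k] H
  Sinv_S : ∀ h, Sinv (S h) = h
  S_Sinv : ∀ h, S (Sinv h) = h
  S_one : S 1 = 1
  S_mul : ∀ a b, S (a * b) = S b * S a
  α : H
  β : H
  antipode₁ : ∀ h, ∑ j, S (Δ1 h j) * α * Δ2 h j = ε h • α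
  antipode₂ : ∀ h, ∑ j, Δ1 h j * β * S (Δ2 h j) = ε h • β
  antipode₃ : ∑ i, X1 i * β * S (X2 i) * α * X3 i = 1
  antipode₄ : ∑ a, S (x1 a) * α * x2 a * β * S (x3 a) = 1

namespace QuasiHopf

variable {k H : Type} [Field k] [Ring H] [Algebra k H] (Q : QuasiHopf k H)

/-- index type for `∑ A¹⊗A²⊗A³⊗A⁴ = (Φ⊗1)(Δ⊗id⊗id)(Φ⁻¹)` -/
abbrev AIdx := Q.I × Q.I' × Q.J

def A1 (t : Q.AIdx) : H := Q.X1 t.1 * Q.Δ1 (Q.x1 t.2.1) t.2.2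
def A2 (t : Q.AIdx) : H := Q.X2 t.1 * Q.Δ2 (Q.x1 t.2.1) t.2.2
def A3 (t : Q.AIdx) : H := Q.X3 t.1 * Q.x2 t.2.1
def A4 (t : Q.AIdx) : H := Q.x3 t.2.1

/-- index type for `∑ B¹⊗B²⊗B³⊗B⁴ = (Δ⊗id⊗id)(Φ)(Φ⁻¹⊗1)` -/
abbrev BIdx := Q.I × Q.J × Q.I'

def B1 (t : Q.BIdx) : H := Q.Δ1 (Q.X1 t.1) t.2.1 * Q.x1 t.2.2
def B2 (t : Q.BIdx) : H := Q.Δ2 (Q.X1 t.1) t.2.1 * Q.x2 t.2.2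
def B3 (t : Q.BIdx) : H := Q.X2 t.1 * Q.x3 t.2.2
def B4 (t : Q.BIdx) : H := Q.X3 t.1

/-- `γ = ∑ S(A²)αA³ ⊗ S(A¹)αA⁴` -/
def gam1 (t : Q.AIdx) : H := Q.S (Q.A2 t) * Q.α * Q.A3 t
def gam2 (t : Q.AIdx) : H := Q.S (Q.A1 t) * Q.α * Q.A4 t

/-- `δ = ∑ B¹βS(B⁴) ⊗ B²βS(B³)` -/
def del1 (t : Q.BIdx) : H := Q.B1 t * Q.β * Q.S (Q.B4 t)
def del2 (t : Q.BIdx) : H := Q.B2 t * Q.β * Q.S (Q.B3 t)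

/-- index type for the components of the Drinfeld twist
`f = ∑ (S⊗S)(Δᵒᵖ(x¹)) γ Δ(x²βS(x³))` -/
abbrev FIdx := Q.I' × Q.J × Q.AIdx × Q.J

def f1 (t : Q.FIdx) : H :=
  Q.S (Q.Δ2 (Q.x1 t.1) t.2.1) * Q.gam1 t.2.2.1
    * Q.Δ1 (Q.x2 t.1 * Q.β * Q.S (Q.x3 t.1)) t.2.2.2
def f2 (t : Q.FIdx) : H :=
  Q.S (Q.Δ1 (Q.x1 t.1) t.2.1) * Q.gam2 t.2.2.1
    * Q.Δ2 (Q.x2 t.1 * Q.β * Q.S (Q.x3 t.1)) t.2.2.2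

/-- index type for the components of
`f⁻¹ = ∑ Δ(S(x¹)αx²) δ (S⊗S)(Δᵒᵖ(x³))` -/
abbrev GIdx := Q.I' × Q.J × Q.BIdx × Q.J

def g1 (t : Q.GIdx) : H :=
  Q.Δ1 (Q.S (Q.x1 t.1) * Q.α * Q.x2 t.1) t.2.1 * Q.del1 t.2.2.1
    * Q.S (Q.Δ2 (Q.x3 t.1) t.2.2.2)
def g2 (t : Q.GIdx) : H :=
  Q.Δ2 (Q.S (Q.x1 t.1) * Q.α * Q.x2 t.1) t.2.1 * Q.del2 t.2.2.1
    * Q.S (Q.Δ1 (Q.x3 t.1) t.2.2.2)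

/-- `q_R = ∑ X¹ ⊗ S⁻¹(αX³)X²` -/
def q1 (i : Q.I) : H := Q.X1 i
def q2 (i : Q.I) : H := Q.Sinv (Q.α * Q.X3 i) * Q.X2 i

/-- `p_R = ∑ x¹ ⊗ x²βS(x³)` -/
def p1 (a : Q.I') : H := Q.x1 a
def p2 (a : Q.I') : H := Q.x2 a * Q.β * Q.S (Q.x3 a)

/-- `p_L = ∑ X²S⁻¹(X¹β) ⊗ X³` -/
def pL1 (i : Q.I) : H := Q.X2 i * Q.Sinv (Q.X1 i * Q.β)
def pL2 (i : Q.I) : H := Q.X3 i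

/-- `q_L = ∑ S(x¹)αx² ⊗ x³` -/
def qL1 (a : Q.I') : H := Q.S (Q.x1 a) * Q.α * Q.x2 a
def qL2 (a : Q.I') : H := Q.x3 a

end QuasiHopf

/-- The linear map `a ⊗ (b ⊗ c) ↦ a ⊗ S(b)αc`. -/
def QuasiHopf.contractAlpha {k H : Type} [Field k] [Ring H] [Algebra k H]
    (Q : QuasiHopf k H) : H ⊗[k] (H ⊗[k] H) →ₗ[k] H ⊗[k] H :=
  TensorProduct.map LinearMap.id
    (TensorProduct.lift (LinearMap.mul k H ∘ₗ LinearMap.mulRight k Q.α ∘ₗ Q.S))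

theorem QuasiHopf.contractAlpha_tmul {k H : Type} [Field k] [Ring H] [Algebra k H]
    (Q : QuasiHopf k H) (a b c : H) :
    Q.contractAlpha (a ⊗ₜ[k] (b ⊗ₜ[k] c)) = a ⊗ₜ[k] (Q.S b * Q.α * c) := by
  simp [QuasiHopf.contractAlpha]

/-- Lemma 4.1, identity (l1): `∑ q¹y¹ ⊗ S(q²y²)y³ = 1 ⊗ α`, where
`q_R = ∑ q¹⊗q² = ∑ X¹ ⊗ S⁻¹(αX³)X²` and `Φ⁻¹ = ∑ y¹⊗y²⊗y³`. -/
theorem qR_phi_inv_identity {k H : Type} [Field k] [Ring H] [Algebra k H]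
    (Q : QuasiHopf k H) :
    ∑ i, ∑ a, (Q.q1 i * Q.x1 a) ⊗ₜ[k] (Q.S (Q.q2 i * Q.x2 a) * Q.x3 a)
      = (1 : H) ⊗ₜ[k] Q.α := by
  have h := congrArg Q.contractAlpha Q.Φ_right_inv
  simpa only [Finset.sum_mul_sum, Algebra.TensorProduct.tmul_mul_tmul,
    Algebra.TensorProduct.one_def, map_sum, QuasiHopf.contractAlpha_tmul, QuasiHopf.q1,
    QuasiHopf.q2, Q.S_mul, Q.S_Sinv, Q.S_one, mul_assoc, one_mul, mul_one] using h
end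
end

section
/- Let H be a quasi-Hopf algebra over a field k with Drinfeld twist f = ∑f¹⊗f² and inverse f⁻¹ = ∑g¹⊗g² = ∑G¹⊗G². Then Φ·(Δ⊗id)(f⁻¹) = ∑ g¹S(X³)f¹ ⊗ g²₁G¹S(X²)f² ⊗ g²₂G²S(X¹), where Φ = ∑X¹⊗X²⊗X³ and Δ(g²) = ∑g²₁⊗g²₂. -/
open scoped TensorProduct

noncomputable section

set_option maxSynthPendingDepth 3

namespace QuasiBialgebra

variable {k H T R : Type} [Field k] [Ring H] [Algebra k H] [Ring T] [Algebra k T]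
  [AddCommGroup R] [Module k R]

/-- Two algebra maps into the same algebra whose images commute elementwise. -/
class Commuting {A B : Type} [Ring A] [Algebra k A] [Ring B] [Algebra k B]
    (φ : A →ₐ[k] T) (ψ : B →ₐ[k] T) : Prop where
  commute : ∀ a b, Commute (φ a) (ψ b)

section Commuting

variable {A B C D : Type} [Ring A] [Algebra k A] [Ring B] [Algebra k B] [Ring C] [Algebra k C]
  [Ring D] [Algebra k D]

instance Commuting.symm (φ : A →ₐ[k] T) (ψ : B →ₐ[k] T) [Commuting φ ψ] :
    Commuting ψ φ :=
  ⟨fun a b => (Commuting.commute b a).symm⟩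

theorem Commuting.mul_comm (φ : A →ₐ[k] T) (ψ : B →ₐ[k] T) [Commuting φ ψ] (a : A) (b : B) :
    φ a * ψ b = ψ b * φ a :=
  Commuting.commute a b

instance (φ : A →ₐ[k] T) (ψ : B →ₐ[k] T) [Commuting φ ψ] (θ : C →ₐ[k] B) :
    Commuting φ (ψ.comp θ) :=
  ⟨fun a c => Commuting.commute a (θ c)⟩

/-- The algebra map `a ⊗ b ↦ φ a * ψ b` attached to a commuting pair. -/
def tensorLift (φ : A →ₐ[k] T) (ψ : B →ₐ[k] T) [Commuting φ ψ] : A ⊗[k] B →ₐ[k] T :=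
  Algebra.TensorProduct.lift φ ψ Commuting.commute

@[simp]
theorem tensorLift_tmul (φ : A →ₐ[k] T) (ψ : B →ₐ[k] T) [Commuting φ ψ] (a : A) (b : B) :
    tensorLift φ ψ (a ⊗ₜ[k] b) = φ a * ψ b :=
  Algebra.TensorProduct.lift_tmul ..

instance (φ : A →ₐ[k] T) (ψ : B →ₐ[k] T) (χ : C →ₐ[k] T) [Commuting φ ψ] [Commuting φ χ]
    [Commuting ψ χ] : Commuting φ (tensorLift ψ χ) := by
  refine ⟨fun a z => ?_⟩
  induction z using TensorProduct.induction_on with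
  | zero => simp
  | tmul b c =>
    rw [tensorLift_tmul]
    exact (Commuting.commute a b).mul_right (Commuting.commute a c)
  | add x y hx hy => rw [map_add]; exact hx.add_right hy

instance : Commuting (Algebra.TensorProduct.includeLeft : A →ₐ[k] A ⊗[k] B)
    (Algebra.TensorProduct.includeRight : B →ₐ[k] A ⊗[k] B) :=
  ⟨fun a b => by simp [Commute, SemiconjBy]⟩

instance (φ : C →ₐ[k] A) (ψ : D →ₐ[k] A) [Commuting φ ψ] :
    Commuting ((Algebra.TensorProduct.includeLeft : A →ₐ[k] A ⊗[k] B).comp φ)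
      ((Algebra.TensorProduct.includeLeft : A →ₐ[k] A ⊗[k] B).comp ψ) :=
  ⟨fun c d => (Commuting.commute c d).map
    (Algebra.TensorProduct.includeLeft : A →ₐ[k] A ⊗[k] B)⟩

instance (φ : C →ₐ[k] B) (ψ : D →ₐ[k] B) [Commuting φ ψ] :
    Commuting ((Algebra.TensorProduct.includeRight : B →ₐ[k] A ⊗[k] B).comp φ)
      ((Algebra.TensorProduct.includeRight : B →ₐ[k] A ⊗[k] B).comp ψ) :=
  ⟨fun c d => (Commuting.commute c d).map
    (Algebra.TensorProduct.includeRight : B →ₐ[k] A ⊗[k] B)⟩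

end Commuting

variable (Q : QuasiBialgebra k H)

/-- The convolution `h ↦ ∑ φ h₁ * ψ h₂` of a commuting pair of algebra maps. -/
def conv (φ ψ : H →ₐ[k] T) [Commuting φ ψ] : H →ₐ[k] T :=
  (tensorLift φ ψ).comp Q.Δmap

theorem conv_def (φ ψ : H →ₐ[k] T) [Commuting φ ψ] (h : H) :
    Q.conv φ ψ h = tensorLift φ ψ (Q.Δmap h) := rfl

theorem conv_apply (φ ψ : H →ₐ[k] T) [Commuting φ ψ] (h : H) :
    Q.conv φ ψ h = ∑ j, φ (Q.Δ1 h j) * ψ (Q.Δ2 h j) := by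
  simp [conv_def, Q.Δ_eq]

instance (φ ψ χ : H →ₐ[k] T) [Commuting φ ψ] [Commuting φ χ] [Commuting ψ χ] :
    Commuting φ (Q.conv ψ χ) :=
  inferInstanceAs (Commuting φ ((tensorLift ψ χ).comp Q.Δmap))

instance (φ ψ χ : H →ₐ[k] T) [Commuting φ ψ] [Commuting φ χ] [Commuting ψ χ] :
    Commuting (Q.conv φ ψ) χ :=
  have : Commuting χ (Q.conv φ ψ) := inferInstance
  inferInstance

/-- The counit, viewed as an algebra map into an arbitrary algebra. -/
def counitMap : H →ₐ[k] T := (Algebra.ofId k T).comp Q.ε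

theorem counitMap_apply (h : H) : (Q.counitMap h : T) = Q.ε h • 1 :=
  Algebra.algebraMap_eq_smul_one _

instance (φ : H →ₐ[k] T) : Commuting Q.counitMap φ :=
  ⟨fun a b => by simp [counitMap_apply, Commute, SemiconjBy]⟩

instance (φ : H →ₐ[k] T) : Commuting φ Q.counitMap :=
  ⟨fun a b => by simp [counitMap_apply, Commute, SemiconjBy]⟩

@[simp]
theorem conv_counitMap (φ : H →ₐ[k] T) : Q.conv φ Q.counitMap = φ := by
  ext h
  conv_rhs => rw [← Q.counit_right h]
  simp [conv_apply, counitMap_apply]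

@[simp]
theorem counitMap_conv (φ : H →ₐ[k] T) : Q.conv Q.counitMap φ = φ := by
  ext h
  conv_rhs => rw [← Q.counit_left h]
  simp [conv_apply, counitMap_apply]

/-- The reassociator `Φ` placed on three legs. -/
def reassoc (φ ψ χ : H →ₐ[k] T) : T := ∑ i, φ (Q.X1 i) * (ψ (Q.X2 i) * χ (Q.X3 i))

/-- The inverse reassociator `Φ⁻¹` placed on three legs. -/
def reassocInv (φ ψ χ : H →ₐ[k] T) : T := ∑ i, φ (Q.x1 i) * (ψ (Q.x2 i) * χ (Q.x3 i))

section Reassoc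

variable (φ ψ χ ω : H →ₐ[k] T) [Commuting φ ψ] [Commuting φ χ] [Commuting ψ χ]

theorem reassoc_mul_reassocInv : Q.reassoc φ ψ χ * Q.reassocInv φ ψ χ = 1 := by
  have := congrArg (tensorLift φ (tensorLift ψ χ)) Q.Φ_right_inv
  simpa [reassoc, reassocInv] using this

theorem reassocInv_mul_reassoc : Q.reassocInv φ ψ χ * Q.reassoc φ ψ χ = 1 := by
  have := congrArg (tensorLift φ (tensorLift ψ χ)) Q.Φ_left_inv
  simpa [reassoc, reassocInv] using this

/-- The reassociator on three pairwise commuting legs, as a unit. -/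
def reassocUnit : Tˣ :=
  ⟨Q.reassoc φ ψ χ, Q.reassocInv φ ψ χ, Q.reassoc_mul_reassocInv φ ψ χ,
    Q.reassocInv_mul_reassoc φ ψ χ⟩

@[simp]
theorem val_reassocUnit : (Q.reassocUnit φ ψ χ : T) = Q.reassoc φ ψ χ := rfl

@[simp]
theorem val_inv_reassocUnit : ((Q.reassocUnit φ ψ χ)⁻¹ : Tˣ) = Q.reassocInv φ ψ χ := rfl

theorem conv_assoc_mul_reassoc (h : H) :
    Q.conv φ (Q.conv ψ χ) h * Q.reassoc φ ψ χ = Q.reassoc φ ψ χ * Q.conv (Q.conv φ ψ) χ h := by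
  have := congrArg (tensorLift φ (tensorLift ψ χ)) (Q.quasi_coassoc h)
  simp only [map_sum, map_mul, tensorLift_tmul] at this
  have h1 : Q.conv φ (Q.conv ψ χ) h = Q.reassoc φ ψ χ * Q.conv (Q.conv φ ψ) χ h *
      Q.reassocInv φ ψ χ := by
    simpa only [conv_apply, reassoc, reassocInv, Finset.mul_sum, Finset.sum_mul, mul_assoc]
      using this
  rw [h1, mul_assoc, reassocInv_mul_reassoc, mul_one]

theorem reassoc_pentagon [Commuting φ ω] [Commuting ψ ω] [Commuting χ ω] :
    Q.reassoc ψ χ ω * Q.reassoc φ (Q.conv ψ χ) ω * Q.reassoc φ ψ χ =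
      Q.reassoc φ ψ (Q.conv χ ω) * Q.reassoc (Q.conv φ ψ) χ ω := by
  have := congrArg (tensorLift φ (tensorLift ψ (tensorLift χ ω))) Q.cocycle
  simp only [map_sum, map_mul, tensorLift_tmul, map_one, one_mul, mul_one] at this
  simpa only [conv_apply, reassoc, Finset.mul_sum, Finset.sum_mul, mul_assoc] using this

@[simp]
theorem reassoc_counitMap_middle : Q.reassoc φ Q.counitMap χ = 1 := by
  have := congrArg (tensorLift φ χ) Q.Φ_normal
  simpa [reassoc, counitMap_apply] using this

@[simp]
theorem reassoc_counitMap_left : Q.reassoc Q.counitMap ψ χ = 1 := by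
  have h := Q.reassoc_pentagon Q.counitMap Q.counitMap ψ χ
  simp only [counitMap_conv, reassoc_counitMap_middle, mul_one, one_mul] at h
  exact (Q.reassocUnit Q.counitMap ψ χ).isUnit.mul_left_cancel (h.trans (mul_one _).symm)

@[simp]
theorem reassoc_counitMap_right : Q.reassoc φ ψ Q.counitMap = 1 := by
  have h := Q.reassoc_pentagon φ ψ Q.counitMap Q.counitMap
  simp only [conv_counitMap, reassoc_counitMap_middle, mul_one, one_mul] at h
  exact (Q.reassocUnit φ ψ Q.counitMap).isUnit.mul_left_cancel (h.trans (mul_one _).symm)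

@[simp]
theorem reassocInv_counitMap_middle : Q.reassocInv φ Q.counitMap χ = 1 := by
  simpa using Q.reassoc_mul_reassocInv φ Q.counitMap χ

@[simp]
theorem reassocInv_counitMap_left : Q.reassocInv Q.counitMap ψ χ = 1 := by
  simpa using Q.reassoc_mul_reassocInv Q.counitMap ψ χ

@[simp]
theorem reassocInv_counitMap_right : Q.reassocInv φ ψ Q.counitMap = 1 := by
  simpa using Q.reassoc_mul_reassocInv φ ψ Q.counitMap

end Reassoc

theorem reassoc_commute (φ ψ χ θ : H →ₐ[k] T) [Commuting φ θ] [Commuting ψ θ] [Commuting χ θ]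
    (h : H) : Commute (Q.reassoc φ ψ χ) (θ h) :=
  Commute.sum_left _ _ _ fun _ _ => (Commuting.commute _ _).mul_left
    ((Commuting.commute _ _).mul_left (Commuting.commute _ _))

theorem reassocInv_commute (φ ψ χ θ : H →ₐ[k] T) [Commuting φ θ] [Commuting ψ θ]
    [Commuting χ θ] (h : H) : Commute (Q.reassocInv φ ψ χ) (θ h) :=
  Commute.sum_left _ _ _ fun _ _ => (Commuting.commute _ _).mul_left
    ((Commuting.commute _ _).mul_left (Commuting.commute _ _))

section Semiconj

variable {x : T} {φ φ' ψ ψ' χ χ' : H →ₐ[k] T}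

theorem semiconjBy_reassoc (hφ : ∀ h, SemiconjBy x (φ h) (φ' h))
    (hψ : ∀ h, SemiconjBy x (ψ h) (ψ' h)) (hχ : ∀ h, SemiconjBy x (χ h) (χ' h)) :
    SemiconjBy x (Q.reassoc φ ψ χ) (Q.reassoc φ' ψ' χ') := by
  simp only [SemiconjBy, reassoc, Finset.mul_sum, Finset.sum_mul]
  exact Finset.sum_congr rfl fun i _ => (hφ _).mul_right ((hψ _).mul_right (hχ _))

theorem semiconjBy_conv [Commuting φ ψ] [Commuting φ' ψ'] (hφ : ∀ h, SemiconjBy x (φ h) (φ' h))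
    (hψ : ∀ h, SemiconjBy x (ψ h) (ψ' h)) (h : H) :
    SemiconjBy x (Q.conv φ ψ h) (Q.conv φ' ψ' h) := by
  simp only [SemiconjBy, conv_apply, Finset.mul_sum, Finset.sum_mul]
  exact Finset.sum_congr rfl fun i _ => (hφ _).mul_right (hψ _)

end Semiconj

/-- The elements `μ a` and `ν a`, multiplied from the left, are indistinguishable for `K`. -/
def LeftEq {A : Type} [Ring A] [Algebra k A] (K : T →ₗ[k] R) (μ ν : A →ₐ[k] T) : Prop :=
  ∀ a w, K (μ a * w) = K (ν a * w)

/-- The elements `μ a` and `ν a`, multiplied from the right, are indistinguishable for `K`. -/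
def RightEq {A : Type} [Ring A] [Algebra k A] (K : T →ₗ[k] R) (μ ν : A →ₐ[k] T) : Prop :=
  ∀ a w, K (w * μ a) = K (w * ν a)

section Functional

variable {A B : Type} [Ring A] [Algebra k A] [Ring B] [Algebra k B] {K : T →ₗ[k] R}

theorem LeftEq.mulLeft {μ μ' : A →ₐ[k] T} (hK : LeftEq K μ μ') {t : T}
    (h : ∀ a, Commute t (μ a)) (h' : ∀ a, Commute t (μ' a)) :
    LeftEq (K ∘ₗ LinearMap.mulLeft k t) μ μ' := fun a w => by
  simp only [LinearMap.comp_apply, LinearMap.mulLeft_apply]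
  rw [(h a).left_comm, (h' a).left_comm, hK]

theorem RightEq.mulRight {μ μ' : A →ₐ[k] T} (hK : RightEq K μ μ') {t : T}
    (h : ∀ a, Commute t (μ a)) (h' : ∀ a, Commute t (μ' a)) :
    RightEq (K ∘ₗ LinearMap.mulRight k t) μ μ' := fun a w => by
  simp only [LinearMap.comp_apply, LinearMap.mulRight_apply]
  rw [mul_assoc, ← (h a).eq, ← mul_assoc, hK, mul_assoc, (h' a).eq, ← mul_assoc]

theorem LeftEq.tensorLift_left {μ μ' : A →ₐ[k] T} (hK : LeftEq K μ μ') (φ : B →ₐ[k] T)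
    [Commuting μ φ] [Commuting μ' φ] : LeftEq K (tensorLift μ φ) (tensorLift μ' φ) := by
  intro z w
  induction z using TensorProduct.induction_on with
  | zero => simp
  | tmul a b => rw [tensorLift_tmul, tensorLift_tmul, mul_assoc, mul_assoc, hK]
  | add x y hx hy => simp only [map_add, add_mul, hx, hy]

theorem LeftEq.tensorLift_right {μ μ' : A →ₐ[k] T} (hK : LeftEq K μ μ') (φ : B →ₐ[k] T)
    [Commuting φ μ] [Commuting φ μ'] : LeftEq K (tensorLift φ μ) (tensorLift φ μ') := by
  intro z w
  induction z using TensorProduct.induction_on with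
  | zero => simp
  | tmul a b =>
    rw [tensorLift_tmul, tensorLift_tmul, Commuting.mul_comm φ μ, Commuting.mul_comm φ μ',
      mul_assoc, mul_assoc, hK]
  | add x y hx hy => simp only [map_add, add_mul, hx, hy]

theorem RightEq.tensorLift_right {μ μ' : A →ₐ[k] T} (hK : RightEq K μ μ') (φ : B →ₐ[k] T)
    [Commuting φ μ] [Commuting φ μ'] : RightEq K (tensorLift φ μ) (tensorLift φ μ') := by
  intro z w
  induction z using TensorProduct.induction_on with
  | zero => simp
  | tmul a b => rw [tensorLift_tmul, tensorLift_tmul, ← mul_assoc, ← mul_assoc, hK]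
  | add x y hx hy => simp only [map_add, mul_add, hx, hy]

theorem RightEq.tensorLift_left {μ μ' : A →ₐ[k] T} (hK : RightEq K μ μ') (φ : B →ₐ[k] T)
    [Commuting μ φ] [Commuting μ' φ] : RightEq K (tensorLift μ φ) (tensorLift μ' φ) := by
  intro z w
  induction z using TensorProduct.induction_on with
  | zero => simp
  | tmul a b =>
    rw [tensorLift_tmul, tensorLift_tmul, Commuting.mul_comm μ φ, Commuting.mul_comm μ' φ,
      ← mul_assoc, ← mul_assoc, hK]
  | add x y hx hy => simp only [map_add, mul_add, hx, hy]

variable {Q} {φ φ' ψ ψ' χ χ' : H →ₐ[k] T}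

theorem LeftEq.conv_left {μ μ' : H →ₐ[k] T} (hK : LeftEq K μ μ') (φ : H →ₐ[k] T)
    [Commuting μ φ] [Commuting μ' φ] : LeftEq K (Q.conv μ φ) (Q.conv μ' φ) :=
  fun h => hK.tensorLift_left φ (Q.Δmap h)

theorem LeftEq.conv_right {μ μ' : H →ₐ[k] T} (hK : LeftEq K μ μ') (φ : H →ₐ[k] T)
    [Commuting φ μ] [Commuting φ μ'] : LeftEq K (Q.conv φ μ) (Q.conv φ μ') :=
  fun h => hK.tensorLift_right φ (Q.Δmap h)

theorem RightEq.conv_left {μ μ' : H →ₐ[k] T} (hK : RightEq K μ μ') (φ : H →ₐ[k] T)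
    [Commuting μ φ] [Commuting μ' φ] : RightEq K (Q.conv μ φ) (Q.conv μ' φ) :=
  fun h => hK.tensorLift_left φ (Q.Δmap h)

theorem RightEq.conv_right {μ μ' : H →ₐ[k] T} (hK : RightEq K μ μ') (φ : H →ₐ[k] T)
    [Commuting φ μ] [Commuting φ μ'] : RightEq K (Q.conv φ μ) (Q.conv φ μ') :=
  fun h => hK.tensorLift_right φ (Q.Δmap h)

variable [Commuting φ ψ] [Commuting φ χ] [Commuting ψ χ]
  [Commuting φ' ψ'] [Commuting φ' χ'] [Commuting ψ' χ']

variable (Q) in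
theorem LeftEq.reassoc
    (hK : LeftEq K (tensorLift φ (tensorLift ψ χ)) (tensorLift φ' (tensorLift ψ' χ'))) (w : T) :
    K (Q.reassoc φ ψ χ * w) = K (Q.reassoc φ' ψ' χ' * w) := by
  simpa [QuasiBialgebra.reassoc] using hK (∑ i, Q.X1 i ⊗ₜ[k] (Q.X2 i ⊗ₜ[k] Q.X3 i)) w

variable (Q) in
theorem LeftEq.reassocInv
    (hK : LeftEq K (tensorLift φ (tensorLift ψ χ)) (tensorLift φ' (tensorLift ψ' χ'))) (w : T) :
    K (Q.reassocInv φ ψ χ * w) = K (Q.reassocInv φ' ψ' χ' * w) := by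
  simpa [QuasiBialgebra.reassocInv] using hK (∑ i, Q.x1 i ⊗ₜ[k] (Q.x2 i ⊗ₜ[k] Q.x3 i)) w

variable (Q) in
theorem RightEq.reassoc
    (hK : RightEq K (tensorLift φ (tensorLift ψ χ)) (tensorLift φ' (tensorLift ψ' χ'))) (w : T) :
    K (w * Q.reassoc φ ψ χ) = K (w * Q.reassoc φ' ψ' χ') := by
  simpa [QuasiBialgebra.reassoc] using hK (∑ i, Q.X1 i ⊗ₜ[k] (Q.X2 i ⊗ₜ[k] Q.X3 i)) w

variable (Q) in
theorem RightEq.reassocInv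
    (hK : RightEq K (tensorLift φ (tensorLift ψ χ)) (tensorLift φ' (tensorLift ψ' χ'))) (w : T) :
    K (w * Q.reassocInv φ ψ χ) = K (w * Q.reassocInv φ' ψ' χ') := by
  simpa [QuasiBialgebra.reassocInv] using hK (∑ i, Q.x1 i ⊗ₜ[k] (Q.x2 i ⊗ₜ[k] Q.x3 i)) w

end Functional

section Coherence

variable (a b c d e f : H →ₐ[k] T)

theorem reassocUnit_pentagon [Commuting a b] [Commuting a c] [Commuting a d] [Commuting b c]
    [Commuting b d] [Commuting c d] :
    Q.reassocUnit b c d * Q.reassocUnit a (Q.conv b c) d * Q.reassocUnit a b c =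
      Q.reassocUnit a b (Q.conv c d) * Q.reassocUnit (Q.conv a b) c d :=
  Units.ext (Q.reassoc_pentagon a b c d)

theorem reassocUnit_natural_left [Commuting a b] [Commuting a c] [Commuting b c] [Commuting a d]
    [Commuting a e] [Commuting b d] [Commuting b e] [Commuting c d] [Commuting c e]
    [Commuting d e] :
    Q.reassocUnit a b c * Q.reassocUnit (Q.conv (Q.conv a b) c) d e =
      Q.reassocUnit (Q.conv a (Q.conv b c)) d e * Q.reassocUnit a b c :=
  Units.ext (Q.semiconjBy_reassoc (fun h => (Q.conv_assoc_mul_reassoc a b c h).symm)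
    (Q.reassoc_commute a b c d) (Q.reassoc_commute a b c e))

theorem reassocUnit_natural_middle [Commuting a b] [Commuting a c] [Commuting b c] [Commuting a d]
    [Commuting a e] [Commuting b d] [Commuting b e] [Commuting c d] [Commuting c e]
    [Commuting d e] :
    Q.reassocUnit a b c * Q.reassocUnit d (Q.conv (Q.conv a b) c) e =
      Q.reassocUnit d (Q.conv a (Q.conv b c)) e * Q.reassocUnit a b c :=
  Units.ext (Q.semiconjBy_reassoc (Q.reassoc_commute a b c d)
    (fun h => (Q.conv_assoc_mul_reassoc a b c h).symm) (Q.reassoc_commute a b c e))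

variable [Commuting a b] [Commuting a c] [Commuting a d] [Commuting a e] [Commuting a f]
  [Commuting b c] [Commuting b d] [Commuting b e] [Commuting b f] [Commuting c d]
  [Commuting c e] [Commuting c f] [Commuting d e] [Commuting d f] [Commuting e f]

theorem reassocUnit_two_pairs :
    Q.reassocUnit c d e * (Q.reassocUnit (Q.conv c d) e f)⁻¹ *
        Q.reassocUnit (Q.conv a b) (Q.conv c d) (Q.conv e f) *
        Q.reassocUnit (Q.conv a b) c d * (Q.reassocUnit a b c)⁻¹ =
      Q.reassocUnit (Q.conv a b) (Q.conv c (Q.conv d e)) f *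
        Q.reassocUnit (Q.conv a b) c (Q.conv d e) * (Q.reassocUnit a b c)⁻¹ *
        Q.reassocUnit (Q.conv a (Q.conv b c)) d e *
        (Q.reassocUnit (Q.conv (Q.conv a (Q.conv b c)) d) e f)⁻¹ := by
  have h1 := Q.reassocUnit_pentagon (Q.conv a b) (Q.conv c d) e f
  have h2 := Q.reassocUnit_natural_middle c d e (Q.conv a b) f
  have h3 := Q.reassocUnit_pentagon (Q.conv a b) c d e
  have h4 := Q.reassocUnit_natural_left (Q.conv a b) c d e f
  have h5 : Q.reassocUnit a b c * Q.reassocUnit (Q.conv (Q.conv (Q.conv a b) c) d) e f =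
      Q.reassocUnit (Q.conv (Q.conv a (Q.conv b c)) d) e f * Q.reassocUnit a b c :=
    Units.ext (Q.semiconjBy_reassoc (Q.semiconjBy_conv
      (fun h => (Q.conv_assoc_mul_reassoc a b c h).symm) (Q.reassoc_commute a b c d))
      (Q.reassoc_commute a b c e) (Q.reassoc_commute a b c f))
  have h6 := Q.reassocUnit_natural_left a b c d e
  rw [← mul_inv_eq_iff_eq_mul] at h1 h2 h3 h4 h5 h6
  rw [← h1, ← h2, ← h3, ← h4, ← h5, ← h6]
  group

variable {K : T →ₗ[k] R}

theorem reassoc_two_pairs_apply (hde : LeftEq K (Q.conv d e) Q.counitMap)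
    (hcf : LeftEq K (Q.conv c f) Q.counitMap) (hbc : RightEq K (Q.conv b c) Q.counitMap)
    (had : RightEq K (Q.conv a d) Q.counitMap) :
    K (Q.reassoc c d e * Q.reassocInv (Q.conv c d) e f *
        Q.reassoc (Q.conv a b) (Q.conv c d) (Q.conv e f) *
        Q.reassoc (Q.conv a b) c d * Q.reassocInv a b c) =
      K (Q.reassoc b c f * Q.reassoc a d e) := by
  have key := congrArg (Units.val) (Q.reassocUnit_two_pairs a b c d e f)
  simp only [Units.val_mul, val_reassocUnit, val_inv_reassocUnit] at key
  have h3 : Q.reassoc (Q.conv a b) c f * Q.reassocInv a b c =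
      Q.reassocInv a b (Q.conv c f) * (Q.reassoc b c f * Q.reassoc a (Q.conv b c) f) := by
    have := Q.reassocUnit_pentagon a b c f
    have : Q.reassocUnit (Q.conv a b) c f * (Q.reassocUnit a b c)⁻¹ =
        (Q.reassocUnit a b (Q.conv c f))⁻¹ *
          (Q.reassocUnit b c f * Q.reassocUnit a (Q.conv b c) f) := by
      rw [eq_inv_mul_iff_mul_eq, ← mul_assoc, ← this, mul_inv_cancel_right]
    simpa using congrArg Units.val this
  have hl1 := ((hde.conv_right (Q := Q) c).tensorLift_left f).tensorLift_right (Q.conv a b)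
  have hl2 := ((hde.mulLeft (Q.reassoc_commute (Q.conv a b) c f (Q.conv d e))
    (Q.reassoc_commute (Q.conv a b) c f Q.counitMap)).tensorLift_right c).tensorLift_right
      (Q.conv a b)
  have hl3 := (hcf.tensorLift_right b).tensorLift_right a
  have hr1 := ((hbc.conv_right (Q := Q) a).conv_left (Q := Q) d).tensorLift_left
    (tensorLift e f)
  have hr2 := had.tensorLift_left (tensorLift e f)
  have hr3 := (hbc.conv_right (Q := Q) a).tensorLift_left (tensorLift d e)
  have hr4 := ((hbc.mulRight (Q.reassoc_commute a d e (Q.conv b c))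
    (Q.reassoc_commute a d e Q.counitMap)).tensorLift_left f).tensorLift_right a
  have e2 := fun w => LeftEq.reassoc Q hl2 w
  have e8 := fun w => RightEq.reassoc Q hr4 w
  simp only [LinearMap.comp_apply, LinearMap.mulLeft_apply, LinearMap.mulRight_apply,
    reassoc_counitMap_right, reassoc_counitMap_middle, one_mul, mul_one] at e2 e8
  rw [key]
  simp only [mul_assoc]
  rw [LeftEq.reassoc Q hl1]
  simp only [conv_counitMap]
  rw [e2, ← mul_assoc (Q.reassoc (Q.conv a b) c f), h3, mul_assoc, LeftEq.reassocInv Q hl3]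
  simp only [← mul_assoc]
  rw [RightEq.reassocInv Q hr1]
  simp only [conv_counitMap]
  rw [RightEq.reassocInv Q hr2, reassocInv_counitMap_left, mul_one, RightEq.reassoc Q hr3]
  simp only [conv_counitMap, reassocInv_counitMap_right, one_mul]
  exact e8 _

theorem reassocInv_two_pairs_apply (hde : RightEq K (Q.conv d e) Q.counitMap)
    (hcf : RightEq K (Q.conv c f) Q.counitMap) (hbc : LeftEq K (Q.conv b c) Q.counitMap)
    (had : LeftEq K (Q.conv a d) Q.counitMap) :
    K (Q.reassoc a b c * Q.reassocInv (Q.conv a b) c d *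
        Q.reassocInv (Q.conv a b) (Q.conv c d) (Q.conv e f) *
        Q.reassoc (Q.conv c d) e f * Q.reassocInv c d e) =
      K (Q.reassocInv a d e * Q.reassocInv b c f) := by
  have key := congrArg (fun u : Tˣ => (u⁻¹).val) (Q.reassocUnit_two_pairs a b c d e f)
  simp only [mul_inv_rev, inv_inv, Units.val_mul, val_reassocUnit, val_inv_reassocUnit] at key
  have h3 : Q.reassoc a b c * Q.reassocInv (Q.conv a b) c f =
      Q.reassocInv a (Q.conv b c) f * Q.reassocInv b c f * Q.reassoc a b (Q.conv c f) := by
    have := Q.reassocUnit_pentagon a b c f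
    have : Q.reassocUnit a b c * (Q.reassocUnit (Q.conv a b) c f)⁻¹ =
        (Q.reassocUnit a (Q.conv b c) f)⁻¹ * (Q.reassocUnit b c f)⁻¹ *
          Q.reassocUnit a b (Q.conv c f) := by
      rw [mul_inv_eq_iff_eq_mul, mul_assoc, ← this]
      group
    simpa using congrArg Units.val this
  have hl1 := ((hde.conv_right (Q := Q) c).tensorLift_left f).tensorLift_right (Q.conv a b)
  have hl2 := ((hde.mulRight (Q.reassocInv_commute (Q.conv a b) c f (Q.conv d e))
    (Q.reassocInv_commute (Q.conv a b) c f Q.counitMap)).tensorLift_right c).tensorLift_right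
      (Q.conv a b)
  have hl3 := (hcf.tensorLift_right b).tensorLift_right a
  have hr1 := ((hbc.conv_right (Q := Q) a).conv_left (Q := Q) d).tensorLift_left
    (tensorLift e f)
  have hr2 := had.tensorLift_left (tensorLift e f)
  have hr3 := (hbc.conv_right (Q := Q) a).tensorLift_left (tensorLift d e)
  have hr4 := ((hbc.mulLeft (Q.reassocInv_commute a d e (Q.conv b c))
    (Q.reassocInv_commute a d e Q.counitMap)).tensorLift_left f).tensorLift_right a
  have e2 := fun w => RightEq.reassocInv Q hl2 w
  have e8 := fun w => LeftEq.reassocInv Q hr4 w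
  simp only [LinearMap.comp_apply, LinearMap.mulLeft_apply, LinearMap.mulRight_apply,
    reassocInv_counitMap_right, reassocInv_counitMap_middle, one_mul, mul_one]
    at e2 e8
  simp only [← mul_assoc] at key
  rw [key, RightEq.reassocInv Q hl1]
  simp only [conv_counitMap]
  rw [e2, mul_assoc _ (Q.reassoc a b c), h3, ← mul_assoc, RightEq.reassoc Q hl3]
  simp only [mul_assoc]
  rw [LeftEq.reassoc Q hr1]
  simp only [conv_counitMap]
  rw [LeftEq.reassoc Q hr2, reassoc_counitMap_left, one_mul, LeftEq.reassocInv Q hr3]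
  simp only [conv_counitMap, reassoc_counitMap_right, mul_one]
  exact e8 _

theorem reassoc_three_pairs_apply (hcd : LeftEq K (Q.conv c d) Q.counitMap) :
    K (Q.reassoc a b e * Q.reassocInv (Q.conv a b) e f * Q.reassoc (Q.conv a b) c d *
        Q.reassocInv (Q.conv (Q.conv a b) c) d (Q.conv e f) * Q.reassoc d e f) =
      K (Q.reassoc b c d * Q.reassocInv (Q.conv b c) d e * Q.reassoc a (Q.conv b c) (Q.conv d e) *
        Q.reassocInv (Q.conv a (Q.conv b c)) (Q.conv d e) f * Q.reassoc a b c) := by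
  have h1 := Q.reassocUnit_pentagon (Q.conv (Q.conv a b) c) d e f
  have h2 := Q.reassocUnit_natural_left (Q.conv a b) c d e f
  have h3 := Q.reassocUnit_natural_left a b c (Q.conv d e) f
  have h4 := Q.reassocUnit_pentagon a (Q.conv b c) d e
  have h5 := Q.reassocUnit_natural_left a b c d e
  have h6 := Q.reassocUnit_natural_middle b c d a e
  have h7 := Q.reassocUnit_pentagon a b c d
  have hL : Q.reassocUnit a b e * (Q.reassocUnit (Q.conv a b) e f)⁻¹ *
        Q.reassocUnit (Q.conv a b) c d *
        (Q.reassocUnit (Q.conv (Q.conv a b) c) d (Q.conv e f))⁻¹ * Q.reassocUnit d e f =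
      Q.reassocUnit a b e * (Q.reassocUnit (Q.conv a b) e f)⁻¹ *
        Q.reassocUnit (Q.conv (Q.conv a b) (Q.conv c d)) e f *
        (Q.reassocUnit (Q.conv a b) c d * (Q.reassocUnit (Q.conv (Q.conv a b) c) d e)⁻¹ *
        (Q.reassocUnit (Q.conv (Q.conv a b) c) (Q.conv d e) f)⁻¹) := by
    rw [← mul_inv_eq_iff_eq_mul] at h1
    rw [← h1, ← mul_inv_eq_iff_eq_mul.mpr h2]
    group
  have hR : Q.reassocUnit b c d * (Q.reassocUnit (Q.conv b c) d e)⁻¹ *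
        Q.reassocUnit a (Q.conv b c) (Q.conv d e) *
        (Q.reassocUnit (Q.conv a (Q.conv b c)) (Q.conv d e) f)⁻¹ * Q.reassocUnit a b c =
      Q.reassocUnit a (Q.conv b (Q.conv c d)) e * Q.reassocUnit a b (Q.conv c d) *
        (Q.reassocUnit (Q.conv a b) c d * (Q.reassocUnit (Q.conv (Q.conv a b) c) d e)⁻¹ *
        (Q.reassocUnit (Q.conv (Q.conv a b) c) (Q.conv d e) f)⁻¹) := by
    rw [← mul_inv_eq_iff_eq_mul] at h3 h4 h5 h6 h7
    rw [← h3, ← h4, ← h5, ← h6, ← h7]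
    group
  replace hL := congrArg Units.val hL
  replace hR := congrArg Units.val hR
  simp only [Units.val_mul, val_reassocUnit, val_inv_reassocUnit] at hL hR
  rw [hL, hR]
  have hl1 := (hcd.mulLeft
    (t := Q.reassoc a b e * Q.reassocInv (Q.conv a b) e f)
    (fun h => (Q.reassoc_commute a b e (Q.conv c d) h).mul_left
      (Q.reassocInv_commute (Q.conv a b) e f (Q.conv c d) h))
    (fun h => (Q.reassoc_commute a b e Q.counitMap h).mul_left
      (Q.reassocInv_commute (Q.conv a b) e f Q.counitMap h)))
  have e1 := fun w => LeftEq.reassoc Q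
    ((hl1.conv_right (Q := Q) (Q.conv a b)).tensorLift_left (tensorLift e f)) w
  have hr1 := ((hcd.conv_right (Q := Q) b).tensorLift_left e).tensorLift_right a
  have hr2 := ((hcd.mulLeft (Q.reassoc_commute a b e (Q.conv c d))
    (Q.reassoc_commute a b e Q.counitMap)).tensorLift_right b).tensorLift_right a
  have e2 := fun w => LeftEq.reassoc Q hr2 w
  simp only [LinearMap.comp_apply, LinearMap.mulLeft_apply, conv_counitMap,
    reassoc_counitMap_right, one_mul] at e1 e2
  rw [mul_assoc _ (Q.reassoc (Q.conv (Q.conv a b) (Q.conv c d)) e f), e1,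
    mul_assoc (Q.reassoc a (Q.conv b (Q.conv c d)) e), LeftEq.reassoc Q hr1]
  simp only [conv_counitMap]
  rw [e2, mul_assoc (Q.reassoc a b e), ← mul_assoc (Q.reassocInv (Q.conv a b) e f),
    reassocInv_mul_reassoc, one_mul]

end Coherence

section Legs

variable (φ₁ φ₂ φ₃ φ₄ : H →ₐ[k] T) [Commuting φ₁ φ₂] [Commuting φ₁ φ₃] [Commuting φ₁ φ₄]
  [Commuting φ₂ φ₃] [Commuting φ₂ φ₄] [Commuting φ₃ φ₄]

theorem mul_four_legs (a b c d a' b' c' d' : H) :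
    φ₁ a * (φ₂ b * (φ₃ c * φ₄ d)) * (φ₁ a' * (φ₂ b' * (φ₃ c' * φ₄ d'))) =
      φ₁ (a * a') * (φ₂ (b * b') * (φ₃ (c * c') * φ₄ (d * d'))) := by
  have := map_mul (tensorLift φ₁ (tensorLift φ₂ (tensorLift φ₃ φ₄)))
    (a ⊗ₜ (b ⊗ₜ (c ⊗ₜ d))) (a' ⊗ₜ (b' ⊗ₜ (c' ⊗ₜ d')))
  simpa only [Algebra.TensorProduct.tmul_mul_tmul, tensorLift_tmul] using this.symm

end Legs

/-- The inclusion of the first leg of `H ⊗ (H ⊗ H)`. -/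
abbrev leg₁ : H →ₐ[k] H ⊗[k] (H ⊗[k] H) := Algebra.TensorProduct.includeLeft

/-- The inclusion of the second leg of `H ⊗ (H ⊗ H)`. -/
abbrev leg₂ : H →ₐ[k] H ⊗[k] (H ⊗[k] H) :=
  Algebra.TensorProduct.includeRight.comp Algebra.TensorProduct.includeLeft

/-- The inclusion of the third leg of `H ⊗ (H ⊗ H)`. -/
abbrev leg₃ : H →ₐ[k] H ⊗[k] (H ⊗[k] H) :=
  Algebra.TensorProduct.includeRight.comp Algebra.TensorProduct.includeRight

/-- The linear map `x ⊗ y ↦ p x * q y`. -/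
def mulMap {M N A : Type} [AddCommGroup M] [Module k M] [AddCommGroup N] [Module k N] [Ring A]
    [Algebra k A] (p : M →ₗ[k] A) (q : N →ₗ[k] A) : M ⊗[k] N →ₗ[k] A :=
  LinearMap.mul' k A ∘ₗ TensorProduct.map p q

@[simp]
theorem mulMap_tmul {M N A : Type} [AddCommGroup M] [Module k M] [AddCommGroup N] [Module k N]
    [Ring A] [Algebra k A] (p : M →ₗ[k] A) (q : N →ₗ[k] A) (x : M) (y : N) :
    mulMap p q (x ⊗ₜ[k] y) = p x * q y := by
  simp [mulMap]

variable {A : Type} [Ring A] [Algebra k A]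

/-- An antipode `σ` along the algebra map `ρ`, with evaluation and coevaluation elements `a`
and `b`: for `ρ = id` these are the antipode axioms of a quasi-Hopf algebra. -/
structure IsAntipode (ρ : H →ₐ[k] A) (σ : H →ₗ[k] A) (a b : A) : Prop where
  map_one : σ 1 = 1
  map_mul : ∀ x y, σ (x * y) = σ y * σ x
  eval : ∀ h, ∑ j, σ (Q.Δ1 h j) * a * ρ (Q.Δ2 h j) = Q.ε h • a
  coeval : ∀ h, ∑ j, ρ (Q.Δ1 h j) * b * σ (Q.Δ2 h j) = Q.ε h • b
  reassoc : ∑ i, ρ (Q.X1 i) * b * σ (Q.X2 i) * a * ρ (Q.X3 i) = 1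
  reassocInv : ∑ i, σ (Q.x1 i) * a * ρ (Q.x2 i) * b * σ (Q.x3 i) = 1

/-- The element comparing two antipodes along the same algebra map. -/
def transfer (ρ : H →ₐ[k] A) (σ' : H →ₗ[k] A) (a' b : A) (σ : H →ₗ[k] A) : A :=
  ∑ i, σ' (Q.x1 i) * a' * ρ (Q.x2 i) * b * σ (Q.x3 i)

namespace IsAntipode

variable {Q} {ρ : H →ₐ[k] A} {σ σ' : H →ₗ[k] A} {a a' b b' : A}

theorem map {B : Type} [Ring B] [Algebra k B] (D : Q.IsAntipode ρ σ a b) (θ : A →ₐ[k] B) :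
    Q.IsAntipode (θ.comp ρ) (θ.toLinearMap ∘ₗ σ) (θ a) (θ b) where
  map_one := by simp [D.map_one]
  map_mul x y := by simp [D.map_mul]
  eval h := by simpa using congrArg θ (D.eval h)
  coeval h := by simpa using congrArg θ (D.coeval h)
  reassoc := by simpa using congrArg θ D.reassoc
  reassocInv := by simpa using congrArg θ D.reassocInv

theorem eval_mul_mul (D : Q.IsAntipode ρ σ a b) (h x y : H) :
    ∑ j, σ (Q.Δ1 h j * x) * a * ρ (Q.Δ2 h j * y) = Q.ε h • (σ x * a * ρ y) := by
  have := congrArg (fun z => σ x * z * ρ y) (D.eval h)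
  simp only [Finset.mul_sum, Finset.sum_mul, mul_smul_comm, smul_mul_assoc] at this
  simpa only [D.map_mul, _root_.map_mul, mul_assoc] using this

theorem coeval_mul_mul (D : Q.IsAntipode ρ σ a b) (h x y : H) :
    ∑ j, ρ (x * Q.Δ1 h j) * b * σ (y * Q.Δ2 h j) = Q.ε h • (ρ x * b * σ y) := by
  have := congrArg (fun z => ρ x * z * σ y) (D.coeval h)
  simp only [Finset.mul_sum, Finset.sum_mul, mul_smul_comm, smul_mul_assoc] at this
  simpa only [D.map_mul, _root_.map_mul, mul_assoc] using this

theorem transfer_mul (D : Q.IsAntipode ρ σ a b) (D' : Q.IsAntipode ρ σ' a' b') (h : H) :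
    Q.transfer ρ σ' a' b σ * σ h = σ' h * Q.transfer ρ σ' a' b σ := by
  let E : H ⊗[k] (H ⊗[k] H) →ₗ[k] A :=
    mulMap σ' (mulMap (LinearMap.mulLeft k a' ∘ₗ LinearMap.mulRight k b ∘ₗ ρ.toLinearMap) σ)
  have hl : LeftEq E (Q.conv leg₁ leg₂) Q.counitMap := fun h w => by
    suffices E ∘ₗ LinearMap.mulLeft k (Q.conv leg₁ leg₂ h) =
      E ∘ₗ LinearMap.mulLeft k (Q.counitMap h) from LinearMap.congr_fun this w
    ext x y z
    have := congrArg (· * (b * σ z)) (D'.eval_mul_mul h x y)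
    simp only [Finset.sum_mul] at this
    simpa [E, conv_apply, counitMap_apply, Finset.sum_mul, mul_assoc] using this
  have hr : RightEq E (Q.conv leg₂ leg₃) Q.counitMap := fun h w => by
    suffices E ∘ₗ LinearMap.mulRight k (Q.conv leg₂ leg₃ h) =
      E ∘ₗ LinearMap.mulRight k (Q.counitMap h) from LinearMap.congr_fun this w
    ext x y z
    have := congrArg (σ' x * a' * ·) (D.coeval_mul_mul h y z)
    simp only [Finset.mul_sum] at this
    simpa [E, conv_apply, counitMap_apply, Finset.mul_sum, mul_assoc] using this
  have key : Q.reassocInv leg₁ leg₂ leg₃ * Q.conv leg₁ (Q.conv leg₂ leg₃) h =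
      Q.conv (Q.conv leg₁ leg₂) leg₃ h * Q.reassocInv leg₁ leg₂ leg₃ := by
    have := Q.conv_assoc_mul_reassoc leg₁ leg₂ leg₃ h
    calc _ = Q.reassocInv leg₁ leg₂ leg₃ * (Q.conv leg₁ (Q.conv leg₂ leg₃) h *
          Q.reassoc leg₁ leg₂ leg₃) * Q.reassocInv leg₁ leg₂ leg₃ := by
          simp only [mul_assoc, reassoc_mul_reassocInv, mul_one]
      _ = _ := by rw [this, ← mul_assoc, reassocInv_mul_reassoc, one_mul]
  have := congrArg E key
  rw [(hr.conv_right (Q := Q) leg₁), (hl.conv_left (Q := Q) leg₃)] at this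
  simp only [conv_counitMap, counitMap_conv] at this
  simpa [E, QuasiBialgebra.reassocInv, Finset.mul_sum, Finset.sum_mul, transfer, D.map_mul,
    D'.map_mul, mul_assoc] using this.symm

theorem transfer_mul_eval (D : Q.IsAntipode ρ σ a b) (D' : Q.IsAntipode ρ σ' a' b') :
    Q.transfer ρ σ' a' b σ * a = a' := by
  let E : H ⊗[k] (H ⊗[k] (H ⊗[k] H)) →ₗ[k] A :=
    mulMap σ' (mulMap (LinearMap.mulLeft k a' ∘ₗ LinearMap.mulRight k b ∘ₗ ρ.toLinearMap)
      (mulMap σ (LinearMap.mulLeft k a ∘ₗ ρ.toLinearMap)))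
  let m₁ : H →ₐ[k] H ⊗[k] (H ⊗[k] (H ⊗[k] H)) := Algebra.TensorProduct.includeLeft
  let m₂ : H →ₐ[k] H ⊗[k] (H ⊗[k] (H ⊗[k] H)) := Algebra.TensorProduct.includeRight.comp leg₁
  let m₃ : H →ₐ[k] H ⊗[k] (H ⊗[k] (H ⊗[k] H)) := Algebra.TensorProduct.includeRight.comp leg₂
  let m₄ : H →ₐ[k] H ⊗[k] (H ⊗[k] (H ⊗[k] H)) := Algebra.TensorProduct.includeRight.comp leg₃
  have hl : LeftEq E (Q.conv m₁ m₂) Q.counitMap := fun h w => by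
    suffices E ∘ₗ LinearMap.mulLeft k (Q.conv m₁ m₂ h) =
      E ∘ₗ LinearMap.mulLeft k (Q.counitMap h) from LinearMap.congr_fun this w
    ext x y z t
    have := congrArg (· * (b * (σ z * (a * ρ t)))) (D'.eval_mul_mul h x y)
    simp only [Finset.sum_mul] at this
    simpa [E, m₁, m₂, conv_apply, counitMap_apply, Finset.sum_mul, mul_assoc] using this
  have hl' : LeftEq E (Q.conv m₃ m₄) Q.counitMap := fun h w => by
    suffices E ∘ₗ LinearMap.mulLeft k (Q.conv m₃ m₄ h) =
      E ∘ₗ LinearMap.mulLeft k (Q.counitMap h) from LinearMap.congr_fun this w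
    ext x y z t
    have := congrArg (σ' x * (a' * (ρ y * b)) * ·) (D.eval_mul_mul h z t)
    simp only [Finset.mul_sum] at this
    simpa [E, m₃, m₄, conv_apply, counitMap_apply, Finset.sum_mul, mul_assoc] using this
  have hr : RightEq E (Q.conv m₂ m₃) Q.counitMap := fun h w => by
    suffices E ∘ₗ LinearMap.mulRight k (Q.conv m₂ m₃ h) =
      E ∘ₗ LinearMap.mulRight k (Q.counitMap h) from LinearMap.congr_fun this w
    ext x y z t
    have := congrArg (σ' x * a' * · * (a * ρ t)) (D.coeval_mul_mul h y z)
    simp only [Finset.mul_sum, Finset.sum_mul] at this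
    simpa [E, m₂, m₃, conv_apply, counitMap_apply, Finset.mul_sum, mul_assoc] using this
  have key : Q.reassocInv m₁ m₂ (Q.conv m₃ m₄) * Q.reassoc m₂ m₃ m₄ =
      Q.reassoc (Q.conv m₁ m₂) m₃ m₄ * Q.reassocInv m₁ m₂ m₃ *
        Q.reassocInv m₁ (Q.conv m₂ m₃) m₄ := by
    have := Q.reassocUnit_pentagon m₁ m₂ m₃ m₄
    have : (Q.reassocUnit m₁ m₂ (Q.conv m₃ m₄))⁻¹ * Q.reassocUnit m₂ m₃ m₄ =
        Q.reassocUnit (Q.conv m₁ m₂) m₃ m₄ * (Q.reassocUnit m₁ m₂ m₃)⁻¹ *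
          (Q.reassocUnit m₁ (Q.conv m₂ m₃) m₄)⁻¹ := by
      rw [inv_mul_eq_iff_eq_mul, ← mul_assoc, ← mul_assoc, ← this]
      group
    simpa using congrArg Units.val this
  have := congrArg E key
  rw [LeftEq.reassocInv Q ((hl'.tensorLift_right m₂).tensorLift_right m₁),
    RightEq.reassocInv Q ((hr.tensorLift_left m₄).tensorLift_right m₁), mul_assoc,
    LeftEq.reassoc Q (hl.tensorLift_left (tensorLift m₃ m₄))] at this
  simp only [reassocInv_counitMap_right, reassocInv_counitMap_middle, reassoc_counitMap_left,
    one_mul, mul_one] at this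
  have h1 : E (Q.reassoc m₂ m₃ m₄) = a' := by
    have := congrArg (a' * ·) D.reassoc
    simp only [Finset.mul_sum, mul_one] at this
    simpa [E, m₂, m₃, m₄, QuasiBialgebra.reassoc, D'.map_one, mul_assoc] using this
  have h2 : E (Q.reassocInv m₁ m₂ m₃) = Q.transfer ρ σ' a' b σ * a := by
    simp [E, m₁, m₂, m₃, QuasiBialgebra.reassocInv, transfer, Finset.sum_mul, mul_assoc]
  rw [← h2, ← this, h1]

theorem transfer_mul_transfer (D : Q.IsAntipode ρ σ a b) (E : Q.IsAntipode ρ σ' a' b') :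
    Q.transfer ρ σ' a' b σ * Q.transfer ρ σ a b' σ' = 1 := by
  rw [← E.reassocInv]
  conv_lhs => rw [transfer.eq_def Q ρ σ a b' σ', Finset.mul_sum]
  refine Finset.sum_congr rfl fun i _ => ?_
  simp only [← mul_assoc]
  rw [D.transfer_mul E, mul_assoc (σ' _), D.transfer_mul_eval E]

/-- An element intertwining the antipode `σ` with a map `τ` is determined by its value on `a`. -/
theorem eq_of_semiconj (D : Q.IsAntipode ρ σ a b) {τ : H → A} {u v : A}
    (hu : ∀ h, SemiconjBy u (σ h) (τ h)) (hv : ∀ h, SemiconjBy v (σ h) (τ h))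
    (huv : u * a = v * a) : u = v := by
  rw [← mul_one u, ← mul_one v, ← D.reassocInv, Finset.mul_sum, Finset.mul_sum]
  refine Finset.sum_congr rfl fun i _ => ?_
  simp only [← mul_assoc]
  rw [(hu _).eq, (hv _).eq, mul_assoc (τ _) u, mul_assoc (τ _) v, huv]

end IsAntipode

end QuasiBialgebra

namespace QuasiBialgebra

variable {k H T R : Type} [Field k] [Ring H] [Algebra k H] [Ring T] [Algebra k T]
  [AddCommGroup R] [Module k R] (Q : QuasiBialgebra k H)

section MapFunctional

variable {A T' R' : Type} [Ring A] [Algebra k A] [Ring T'] [Algebra k T'] [AddCommGroup R']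
  [Module k R'] {K : T →ₗ[k] R} {K' : T' →ₗ[k] R'}

theorem LeftEq.map_includeLeft {μ μ' : A →ₐ[k] T} (hK : LeftEq K μ μ') :
    LeftEq (TensorProduct.map K K')
      ((Algebra.TensorProduct.includeLeft : T →ₐ[k] T ⊗[k] T').comp μ)
      ((Algebra.TensorProduct.includeLeft : T →ₐ[k] T ⊗[k] T').comp μ') := fun a w => by
  induction w using TensorProduct.induction_on with
  | zero => simp
  | tmul x y => simp [hK a x]
  | add x y hx hy => simp only [map_add, mul_add, hx, hy]

theorem LeftEq.map_includeRight {μ μ' : A →ₐ[k] T'} (hK : LeftEq K' μ μ') :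
    LeftEq (TensorProduct.map K K')
      ((Algebra.TensorProduct.includeRight : T' →ₐ[k] T ⊗[k] T').comp μ)
      ((Algebra.TensorProduct.includeRight : T' →ₐ[k] T ⊗[k] T').comp μ') := fun a w => by
  induction w using TensorProduct.induction_on with
  | zero => simp
  | tmul x y => simp [hK a y]
  | add x y hx hy => simp only [map_add, mul_add, hx, hy]

theorem RightEq.map_includeLeft {μ μ' : A →ₐ[k] T} (hK : RightEq K μ μ') :
    RightEq (TensorProduct.map K K')
      ((Algebra.TensorProduct.includeLeft : T →ₐ[k] T ⊗[k] T').comp μ)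
      ((Algebra.TensorProduct.includeLeft : T →ₐ[k] T ⊗[k] T').comp μ') := fun a w => by
  induction w using TensorProduct.induction_on with
  | zero => simp
  | tmul x y => simp [hK a x]
  | add x y hx hy => simp only [map_add, add_mul, hx, hy]

theorem RightEq.map_includeRight {μ μ' : A →ₐ[k] T'} (hK : RightEq K' μ μ') :
    RightEq (TensorProduct.map K K')
      ((Algebra.TensorProduct.includeRight : T' →ₐ[k] T ⊗[k] T').comp μ)
      ((Algebra.TensorProduct.includeRight : T' →ₐ[k] T ⊗[k] T').comp μ') := fun a w => by
  induction w using TensorProduct.induction_on with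
  | zero => simp
  | tmul x y => simp [hK a y]
  | add x y hx hy => simp only [map_add, add_mul, hx, hy]

end MapFunctional

theorem comp_conv {T' : Type} [Ring T'] [Algebra k T'] (θ : T →ₐ[k] T') (φ ψ : H →ₐ[k] T)
    [Commuting φ ψ] [Commuting (θ.comp φ) (θ.comp ψ)] :
    θ.comp (Q.conv φ ψ) = Q.conv (θ.comp φ) (θ.comp ψ) := by
  ext h
  simp [conv_apply]

theorem comp_counitMap {T' : Type} [Ring T'] [Algebra k T'] (θ : T →ₐ[k] T') :
    θ.comp (Q.counitMap : H →ₐ[k] T) = Q.counitMap := by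
  ext h
  simp [counitMap_apply]

section SemiconjConv

variable (φ ψ χ ω : H →ₐ[k] T) [Commuting φ ψ] [Commuting φ χ] [Commuting ψ χ]

theorem semiconjBy_reassoc_conv (h : H) : SemiconjBy (Q.reassoc φ ψ χ)
    (Q.conv (Q.conv φ ψ) χ h) (Q.conv φ (Q.conv ψ χ) h) :=
  (Q.conv_assoc_mul_reassoc φ ψ χ h).symm

theorem semiconjBy_reassocInv_conv (h : H) : SemiconjBy (Q.reassocInv φ ψ χ)
    (Q.conv φ (Q.conv ψ χ) h) (Q.conv (Q.conv φ ψ) χ h) :=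
  SemiconjBy.units_inv_symm_left (a := Q.reassocUnit φ ψ χ) (Q.semiconjBy_reassoc_conv φ ψ χ h)

variable [Commuting φ ω] [Commuting ψ ω] [Commuting χ ω]

theorem semiconjBy_reassoc_mul_reassocInv_conv (h : H) :
    SemiconjBy (Q.reassoc φ ψ χ * Q.reassocInv (Q.conv φ ψ) χ ω)
      (Q.conv (Q.conv φ ψ) (Q.conv χ ω) h) (Q.conv (Q.conv φ (Q.conv ψ χ)) ω h) :=
  (Q.semiconjBy_conv (Q.semiconjBy_reassoc_conv φ ψ χ) (Q.reassoc_commute φ ψ χ ω) h).mul_left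
    (Q.semiconjBy_reassocInv_conv (Q.conv φ ψ) χ ω h)

theorem semiconjBy_reassoc_conv_mul_reassocInv (h : H) :
    SemiconjBy (Q.reassoc (Q.conv φ ψ) χ ω * Q.reassocInv φ ψ χ)
      (Q.conv (Q.conv φ (Q.conv ψ χ)) ω h) (Q.conv (Q.conv φ ψ) (Q.conv χ ω) h) :=
  (Q.semiconjBy_reassoc_conv (Q.conv φ ψ) χ ω h).mul_left
    (Q.semiconjBy_conv (Q.semiconjBy_reassocInv_conv φ ψ χ) (Q.reassocInv_commute φ ψ χ ω) h)

end SemiconjConv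

theorem map_reassoc {T' : Type} [Ring T'] [Algebra k T'] (θ : T →ₐ[k] T') (φ ψ χ : H →ₐ[k] T) :
    θ (Q.reassoc φ ψ χ) = Q.reassoc (θ.comp φ) (θ.comp ψ) (θ.comp χ) := by
  simp [reassoc]

theorem map_reassocInv {T' : Type} [Ring T'] [Algebra k T'] (θ : T →ₐ[k] T')
    (φ ψ χ : H →ₐ[k] T) :
    θ (Q.reassocInv φ ψ χ) = Q.reassocInv (θ.comp φ) (θ.comp ψ) (θ.comp χ) := by
  simp [reassocInv]

end QuasiBialgebra

namespace QuasiHopf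

open QuasiBialgebra

variable {k H T : Type} [Field k] [Ring H] [Algebra k H] [Ring T] [Algebra k T]
  (Q : QuasiHopf k H)

theorem isAntipode_id : Q.IsAntipode (AlgHom.id k H) Q.S Q.α Q.β where
  map_one := Q.S_one
  map_mul := Q.S_mul
  eval := Q.antipode₁
  coeval := Q.antipode₂
  reassoc := Q.antipode₃
  reassocInv := Q.antipode₄

/-- The anti-multiplicative map `x ⊗ y ↦ S y ⊗ S x`. -/
def antipodeSwap : H ⊗[k] H →ₗ[k] H ⊗[k] H :=
  TensorProduct.map Q.S Q.S ∘ₗ (TensorProduct.comm k H H).toLinearMap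

@[simp]
theorem antipodeSwap_tmul (x y : H) : Q.antipodeSwap (x ⊗ₜ[k] y) = Q.S y ⊗ₜ[k] Q.S x := by
  simp [antipodeSwap]

theorem antipodeSwap_one : Q.antipodeSwap 1 = 1 := by
  simp [Algebra.TensorProduct.one_def, Q.S_one]

theorem antipodeSwap_mul (x y : H ⊗[k] H) :
    Q.antipodeSwap (x * y) = Q.antipodeSwap y * Q.antipodeSwap x := by
  induction x using TensorProduct.induction_on with
  | zero => simp
  | add x x' hx hx' => simp only [add_mul, mul_add, map_add, hx, hx']
  | tmul a b =>
    induction y using TensorProduct.induction_on with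
    | zero => simp
    | add y y' hy hy' => simp only [add_mul, mul_add, map_add, hy, hy']
    | tmul c d => simp [Q.S_mul]

/-- The element `γ`. -/
def gamma : H ⊗[k] H := ∑ t, Q.gam1 t ⊗ₜ[k] Q.gam2 t

/-- The element `δ`. -/
def delta : H ⊗[k] H := ∑ t, Q.del1 t ⊗ₜ[k] Q.del2 t

section Legs

variable (φ₁ φ₂ φ₃ φ₄ : H →ₐ[k] T) [Commuting φ₁ φ₂] [Commuting φ₁ φ₃] [Commuting φ₁ φ₄]
  [Commuting φ₂ φ₃] [Commuting φ₂ φ₄] [Commuting φ₃ φ₄]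

theorem reassoc_mul_reassocInv_conv :
    Q.reassoc φ₁ φ₂ φ₃ * Q.reassocInv (Q.conv φ₁ φ₂) φ₃ φ₄ =
      ∑ t, φ₁ (Q.A1 t) * (φ₂ (Q.A2 t) * (φ₃ (Q.A3 t) * φ₄ (Q.A4 t))) := by
  have h1 : Q.reassoc φ₁ φ₂ φ₃ =
      ∑ i, φ₁ (Q.X1 i) * (φ₂ (Q.X2 i) * (φ₃ (Q.X3 i) * φ₄ 1)) := by
    simp [QuasiBialgebra.reassoc]
  have h2 : Q.reassocInv (Q.conv φ₁ φ₂) φ₃ φ₄ = ∑ a, ∑ j, φ₁ (Q.Δ1 (Q.x1 a) j) *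
      (φ₂ (Q.Δ2 (Q.x1 a) j) * (φ₃ (Q.x2 a) * φ₄ (Q.x3 a))) := by
    simp only [QuasiBialgebra.reassocInv, conv_apply, Finset.sum_mul, mul_assoc]
  rw [h1, h2]
  simp only [Finset.sum_mul, Finset.mul_sum, mul_four_legs, one_mul, Fintype.sum_prod_type,
    A1, A2, A3, A4]
  simp only [Finset.sum_comm (t := (Finset.univ : Finset Q.I))]

theorem reassoc_conv_mul_reassocInv :
    Q.reassoc (Q.conv φ₁ φ₂) φ₃ φ₄ * Q.reassocInv φ₁ φ₂ φ₃ =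
      ∑ t, φ₁ (Q.B1 t) * (φ₂ (Q.B2 t) * (φ₃ (Q.B3 t) * φ₄ (Q.B4 t))) := by
  have h1 : Q.reassocInv φ₁ φ₂ φ₃ =
      ∑ i, φ₁ (Q.x1 i) * (φ₂ (Q.x2 i) * (φ₃ (Q.x3 i) * φ₄ 1)) := by
    simp [QuasiBialgebra.reassocInv]
  have h2 : Q.reassoc (Q.conv φ₁ φ₂) φ₃ φ₄ = ∑ a, ∑ j, φ₁ (Q.Δ1 (Q.X1 a) j) *
      (φ₂ (Q.Δ2 (Q.X1 a) j) * (φ₃ (Q.X2 a) * φ₄ (Q.X3 a))) := by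
    simp only [QuasiBialgebra.reassoc, conv_apply, Finset.sum_mul, mul_assoc]
  rw [h1, h2]
  simp only [Finset.sum_mul, Finset.mul_sum, mul_four_legs, mul_one, Fintype.sum_prod_type,
    B1, B2, B3, B4]
  rw [Finset.sum_comm]
  refine Finset.sum_congr rfl fun i _ => ?_
  rw [Finset.sum_comm]

end Legs

/-- The linear map `x ⊗ y ↦ S x * α * y`. -/
def evalMap : H ⊗[k] H →ₗ[k] H := mulMap Q.S (LinearMap.mulLeft k Q.α)

/-- The linear map `x ⊗ y ↦ x * β * S y`. -/
def coevalMap : H ⊗[k] H →ₗ[k] H := mulMap (LinearMap.mulRight k Q.β) Q.S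

@[simp]
theorem evalMap_tmul (x y : H) : Q.evalMap (x ⊗ₜ[k] y) = Q.S x * (Q.α * y) := by
  simp [evalMap]

@[simp]
theorem coevalMap_tmul (x y : H) : Q.coevalMap (x ⊗ₜ[k] y) = x * Q.β * Q.S y := by
  simp [coevalMap]

theorem leftEq_evalMap : LeftEq Q.evalMap
    (Q.conv Algebra.TensorProduct.includeLeft Algebra.TensorProduct.includeRight)
    Q.counitMap := fun h w => by
  suffices Q.evalMap ∘ₗ LinearMap.mulLeft k
      (Q.conv Algebra.TensorProduct.includeLeft Algebra.TensorProduct.includeRight h) =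
    Q.evalMap ∘ₗ LinearMap.mulLeft k (Q.counitMap h) from LinearMap.congr_fun this w
  ext x y
  have := Q.isAntipode_id.eval_mul_mul h x y
  simpa [conv_apply, counitMap_apply, Finset.sum_mul, mul_assoc] using this

theorem rightEq_coevalMap : RightEq Q.coevalMap
    (Q.conv Algebra.TensorProduct.includeLeft Algebra.TensorProduct.includeRight)
    Q.counitMap := fun h w => by
  suffices Q.coevalMap ∘ₗ LinearMap.mulRight k
      (Q.conv Algebra.TensorProduct.includeLeft Algebra.TensorProduct.includeRight h) =
    Q.coevalMap ∘ₗ LinearMap.mulRight k (Q.counitMap h) from LinearMap.congr_fun this w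
  ext x y
  have := Q.isAntipode_id.coeval_mul_mul h x y
  simpa [conv_apply, counitMap_apply, Finset.mul_sum, mul_assoc] using this

/-- The anti-multiplicative map `h ↦ ∑ S h₂ ⊗ S h₁`. -/
def comulAntipode : H →ₗ[k] H ⊗[k] H := Q.antipodeSwap ∘ₗ Q.Δmap.toLinearMap

theorem comulAntipode_apply (h : H) : Q.comulAntipode h = Q.antipodeSwap (Q.Δmap h) := rfl

section EvalPair

/-- The first leg of `(H ⊗ H) ⊗ (H ⊗ H)`. -/
abbrev legLL : H →ₐ[k] (H ⊗[k] H) ⊗[k] (H ⊗[k] H) :=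
  Algebra.TensorProduct.includeLeft.comp Algebra.TensorProduct.includeLeft

/-- The second leg of `(H ⊗ H) ⊗ (H ⊗ H)`. -/
abbrev legLR : H →ₐ[k] (H ⊗[k] H) ⊗[k] (H ⊗[k] H) :=
  Algebra.TensorProduct.includeLeft.comp Algebra.TensorProduct.includeRight

/-- The third leg of `(H ⊗ H) ⊗ (H ⊗ H)`. -/
abbrev legRL : H →ₐ[k] (H ⊗[k] H) ⊗[k] (H ⊗[k] H) :=
  Algebra.TensorProduct.includeRight.comp Algebra.TensorProduct.includeLeft

/-- The fourth leg of `(H ⊗ H) ⊗ (H ⊗ H)`. -/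
abbrev legRR : H →ₐ[k] (H ⊗[k] H) ⊗[k] (H ⊗[k] H) :=
  Algebra.TensorProduct.includeRight.comp Algebra.TensorProduct.includeRight

theorem map_evalMap_mul (t : (H ⊗[k] H) ⊗[k] (H ⊗[k] H)) (p p' : H ⊗[k] H) :
    TensorProduct.map Q.evalMap Q.evalMap
        (t * (tensorLift legRL legLL p * tensorLift legLR legRR p')) =
      Q.antipodeSwap p * TensorProduct.map Q.evalMap Q.evalMap t * p' := by
  induction p using TensorProduct.induction_on with
  | zero => simp
  | add x y hx hy => simp only [map_add, add_mul, mul_add, hx, hy]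
  | tmul a b =>
    induction p' using TensorProduct.induction_on with
    | zero => simp
    | add x y hx hy => simp only [map_add, mul_add, hx, hy]
    | tmul c d =>
      induction t using TensorProduct.induction_on with
      | zero => simp
      | add x y hx hy => simp only [map_add, add_mul, mul_add, hx, hy]
      | tmul x y =>
        induction x using TensorProduct.induction_on with
        | zero => simp
        | add x x' hx hx' => simp only [map_add, add_mul, mul_add, TensorProduct.add_tmul, hx, hx']
        | tmul x₁ x₂ =>
          induction y using TensorProduct.induction_on with
          | zero => simp
          | add x x' hx hx' =>
            simp only [map_add, add_mul, mul_add, TensorProduct.tmul_add, hx, hx']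
          | tmul y₁ y₂ => simp [Q.S_mul, mul_assoc]

theorem map_coevalMap_mul (t : (H ⊗[k] H) ⊗[k] (H ⊗[k] H)) (p p' : H ⊗[k] H) :
    TensorProduct.map Q.coevalMap Q.coevalMap
        (tensorLift legLL legRL p * tensorLift legRR legLR p' * t) =
      p * TensorProduct.map Q.coevalMap Q.coevalMap t * Q.antipodeSwap p' := by
  induction p using TensorProduct.induction_on with
  | zero => simp
  | add x y hx hy => simp only [map_add, add_mul, hx, hy]
  | tmul a b =>
    induction p' using TensorProduct.induction_on with
    | zero => simp
    | add x y hx hy => simp only [map_add, mul_add, add_mul, hx, hy]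
    | tmul c d =>
      induction t using TensorProduct.induction_on with
      | zero => simp
      | add x y hx hy => simp only [map_add, add_mul, mul_add, hx, hy]
      | tmul x y =>
        induction x using TensorProduct.induction_on with
        | zero => simp
        | add x x' hx hx' => simp only [map_add, add_mul, mul_add, TensorProduct.add_tmul, hx, hx']
        | tmul x₁ x₂ =>
          induction y using TensorProduct.induction_on with
          | zero => simp
          | add x x' hx hx' =>
            simp only [map_add, add_mul, mul_add, TensorProduct.tmul_add, hx, hx']
          | tmul y₁ y₂ => simp [Q.S_mul, mul_assoc]

theorem gamma_eq : Q.gamma = TensorProduct.map Q.evalMap Q.evalMap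
    (Q.reassoc legRL legLL legLR * Q.reassocInv (Q.conv legRL legLL) legLR legRR) := by
  rw [reassoc_mul_reassocInv_conv, map_sum, gamma]
  simp [gam1, gam2, mul_assoc]

theorem delta_eq : Q.delta = TensorProduct.map Q.coevalMap Q.coevalMap
    (Q.reassoc (Q.conv legLL legRL) legRR legLR * Q.reassocInv legLL legRL legRR) := by
  rw [reassoc_conv_mul_reassocInv, map_sum, delta]
  simp [del1, del2, mul_assoc]

theorem gamma_eval (h : H) : ∑ j, Q.comulAntipode (Q.Δ1 h j) * Q.gamma *
    Q.Δmap (Q.Δ2 h j) = Q.ε h • Q.gamma := by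
  have h1 : LeftEq (TensorProduct.map Q.evalMap Q.evalMap) (Q.conv legLL legLR) Q.counitMap := by
    have := Q.leftEq_evalMap.map_includeLeft (K' := Q.evalMap)
    rwa [comp_conv, comp_counitMap] at this
  have h2 : LeftEq (TensorProduct.map Q.evalMap Q.evalMap) (Q.conv legRL legRR) Q.counitMap := by
    have := Q.leftEq_evalMap.map_includeRight (K := Q.evalMap)
    rwa [comp_conv, comp_counitMap] at this
  have key : Q.reassoc legRL legLL legLR * Q.reassocInv (Q.conv legRL legLL) legLR legRR *
      Q.conv (Q.conv legRL legLL) (Q.conv legLR legRR) h =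
      Q.conv (Q.conv legRL (Q.conv legLL legLR)) legRR h * (Q.reassoc legRL legLL legLR *
        Q.reassocInv (Q.conv legRL legLL) legLR legRR) :=
    Q.semiconjBy_reassoc_mul_reassocInv_conv legRL legLL legLR legRR h
  have := congrArg (TensorProduct.map Q.evalMap Q.evalMap) key
  rw [(h1.conv_right (Q := Q.toQuasiBialgebra) legRL).conv_left (Q := Q.toQuasiBialgebra) legRR]
    at this
  simp only [conv_counitMap] at this
  rw [h2, counitMap_apply, smul_mul_assoc, one_mul, map_smul, ← gamma_eq,
    conv_apply, Finset.mul_sum, map_sum] at this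
  simpa only [comulAntipode_apply, conv_def, map_evalMap_mul, ← gamma_eq] using this

theorem delta_coeval (h : H) : ∑ j, Q.Δmap (Q.Δ1 h j) * Q.delta *
    Q.comulAntipode (Q.Δ2 h j) = Q.ε h • Q.delta := by
  have h1 : RightEq (TensorProduct.map Q.coevalMap Q.coevalMap) (Q.conv legRL legRR)
      Q.counitMap := by
    have := Q.rightEq_coevalMap.map_includeRight (K := Q.coevalMap)
    rwa [comp_conv, comp_counitMap] at this
  have h2 : RightEq (TensorProduct.map Q.coevalMap Q.coevalMap) (Q.conv legLL legLR)
      Q.counitMap := by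
    have := Q.rightEq_coevalMap.map_includeLeft (K' := Q.coevalMap)
    rwa [comp_conv, comp_counitMap] at this
  have key := (Q.semiconjBy_reassoc_conv_mul_reassocInv legLL legRL legRR legLR h).symm
  have := congrArg (TensorProduct.map Q.coevalMap Q.coevalMap) key
  rw [(h1.conv_right (Q := Q.toQuasiBialgebra) legLL).conv_left (Q := Q.toQuasiBialgebra) legLR]
    at this
  simp only [conv_counitMap] at this
  rw [h2, counitMap_apply, mul_smul_comm, mul_one, map_smul, ← delta_eq,
    conv_apply, Finset.sum_mul, map_sum] at this
  simpa only [comulAntipode_apply, conv_def, map_coevalMap_mul, ← delta_eq] using this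

end EvalPair

section Pairing

/-- The linear map `x ⊗ y ⊗ z ↦ x * β * S y * α * z`. -/
def coevalEvalMap : H ⊗[k] (H ⊗[k] H) →ₗ[k] H := mulMap (LinearMap.mulRight k Q.β) Q.evalMap

/-- The linear map `x ⊗ y ⊗ z ↦ S x * α * y * β * S z`. -/
def evalCoevalMap : H ⊗[k] (H ⊗[k] H) →ₗ[k] H :=
  mulMap Q.S (LinearMap.mulLeft k Q.α ∘ₗ Q.coevalMap)

@[simp]
theorem coevalEvalMap_tmul (x y z : H) :
    Q.coevalEvalMap (x ⊗ₜ[k] (y ⊗ₜ[k] z)) = x * Q.β * (Q.S y * (Q.α * z)) := by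
  simp [coevalEvalMap]

@[simp]
theorem evalCoevalMap_tmul (x y z : H) :
    Q.evalCoevalMap (x ⊗ₜ[k] (y ⊗ₜ[k] z)) = Q.S x * (Q.α * (y * Q.β * Q.S z)) := by
  simp [evalCoevalMap]

theorem leftEq_coevalEvalMap : LeftEq Q.coevalEvalMap (Q.conv leg₂ leg₃) Q.counitMap :=
    fun h w => by
  suffices Q.coevalEvalMap ∘ₗ LinearMap.mulLeft k (Q.conv leg₂ leg₃ h) =
    Q.coevalEvalMap ∘ₗ LinearMap.mulLeft k (Q.counitMap h) from LinearMap.congr_fun this w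
  ext x y z
  have := congrArg (x * Q.β * ·) (Q.isAntipode_id.eval_mul_mul h y z)
  simp only [Finset.mul_sum] at this
  simpa [conv_apply, counitMap_apply, Finset.sum_mul, mul_assoc] using this

theorem rightEq_coevalEvalMap : RightEq Q.coevalEvalMap (Q.conv leg₁ leg₂) Q.counitMap :=
    fun h w => by
  suffices Q.coevalEvalMap ∘ₗ LinearMap.mulRight k (Q.conv leg₁ leg₂ h) =
    Q.coevalEvalMap ∘ₗ LinearMap.mulRight k (Q.counitMap h) from LinearMap.congr_fun this w
  ext x y z
  have := congrArg (· * (Q.α * z)) (Q.isAntipode_id.coeval_mul_mul h x y)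
  simp only [Finset.sum_mul] at this
  simpa [conv_apply, counitMap_apply, Finset.mul_sum, mul_assoc] using this

theorem leftEq_evalCoevalMap : LeftEq Q.evalCoevalMap (Q.conv leg₁ leg₂) Q.counitMap :=
    fun h w => by
  suffices Q.evalCoevalMap ∘ₗ LinearMap.mulLeft k (Q.conv leg₁ leg₂ h) =
    Q.evalCoevalMap ∘ₗ LinearMap.mulLeft k (Q.counitMap h) from LinearMap.congr_fun this w
  ext x y z
  have := congrArg (· * (Q.β * Q.S z)) (Q.isAntipode_id.eval_mul_mul h x y)
  simp only [Finset.sum_mul] at this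
  simpa [conv_apply, counitMap_apply, Finset.sum_mul, mul_assoc] using this

theorem rightEq_evalCoevalMap : RightEq Q.evalCoevalMap (Q.conv leg₂ leg₃) Q.counitMap :=
    fun h w => by
  suffices Q.evalCoevalMap ∘ₗ LinearMap.mulRight k (Q.conv leg₂ leg₃ h) =
    Q.evalCoevalMap ∘ₗ LinearMap.mulRight k (Q.counitMap h) from LinearMap.congr_fun this w
  ext x y z
  have := congrArg (Q.S x * Q.α * ·) (Q.isAntipode_id.coeval_mul_mul h y z)
  simp only [Finset.mul_sum] at this
  simpa [conv_apply, counitMap_apply, Finset.mul_sum, mul_assoc] using this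

theorem coevalEvalMap_reassoc : Q.coevalEvalMap (Q.reassoc leg₁ leg₂ leg₃) = 1 := by
  have := Q.antipode₃
  simpa [QuasiBialgebra.reassoc, mul_assoc] using this

theorem evalCoevalMap_reassocInv : Q.evalCoevalMap (Q.reassocInv leg₁ leg₂ leg₃) = 1 := by
  have := Q.antipode₄
  simpa [QuasiBialgebra.reassocInv, mul_assoc] using this

/-- The inclusion of the first factor of `(H ⊗ (H ⊗ H)) ⊗ (H ⊗ (H ⊗ H))`. -/
abbrev inclL (k H : Type) [Field k] [Ring H] [Algebra k H] :
    H ⊗[k] (H ⊗[k] H) →ₐ[k] (H ⊗[k] (H ⊗[k] H)) ⊗[k] (H ⊗[k] (H ⊗[k] H)) :=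
  Algebra.TensorProduct.includeLeft

/-- The inclusion of the second factor of `(H ⊗ (H ⊗ H)) ⊗ (H ⊗ (H ⊗ H))`. -/
abbrev inclR (k H : Type) [Field k] [Ring H] [Algebra k H] :
    H ⊗[k] (H ⊗[k] H) →ₐ[k] (H ⊗[k] (H ⊗[k] H)) ⊗[k] (H ⊗[k] (H ⊗[k] H)) :=
  Algebra.TensorProduct.includeRight

theorem map_coevalEvalMap_mul_mul (a₁ a₂ a₃ a₄ b₁ b₂ b₃ b₄ : H) (p p' p'' : H ⊗[k] H) :
    TensorProduct.map Q.coevalEvalMap Q.coevalEvalMap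
      ((inclR k H).comp leg₂ a₁ * ((inclL k H).comp leg₂ a₂ *
        ((inclL k H).comp leg₃ a₃ * (inclR k H).comp leg₃ a₄)) *
        (tensorLift ((inclL k H).comp leg₁) ((inclR k H).comp leg₁) p *
          (tensorLift ((inclR k H).comp leg₂) ((inclL k H).comp leg₂) p' *
            tensorLift ((inclL k H).comp leg₃) ((inclR k H).comp leg₃) p'')) *
        ((inclL k H).comp leg₁ b₁ * ((inclR k H).comp leg₁ b₂ *
          ((inclR k H).comp leg₂ b₃ * (inclL k H).comp leg₂ b₄)))) =
      p * ((b₁ * Q.β * Q.S b₄) ⊗ₜ[k] (b₂ * Q.β * Q.S b₃)) * Q.antipodeSwap p' *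
        ((Q.S a₂ * Q.α * a₃) ⊗ₜ[k] (Q.S a₁ * Q.α * a₄)) * p'' := by
  induction p using TensorProduct.induction_on with
  | zero => simp
  | add x y hx hy => simp only [map_add, add_mul, mul_add, hx, hy]
  | tmul p₁ p₂ =>
    induction p' using TensorProduct.induction_on with
    | zero => simp
    | add x y hx hy => simp only [map_add, add_mul, mul_add, hx, hy]
    | tmul q₁ q₂ =>
      induction p'' using TensorProduct.induction_on with
      | zero => simp
      | add x y hx hy => simp only [map_add, add_mul, mul_add, hx, hy]
      | tmul r₁ r₂ => simp [Q.S_mul, mul_assoc]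

theorem map_evalCoevalMap_mul_mul (a₁ a₂ a₃ a₄ b₁ b₂ b₃ b₄ : H) (p p' p'' : H ⊗[k] H) :
    TensorProduct.map Q.evalCoevalMap Q.evalCoevalMap
      ((inclR k H).comp leg₁ a₁ * ((inclL k H).comp leg₁ a₂ *
        ((inclL k H).comp leg₂ a₃ * (inclR k H).comp leg₂ a₄)) *
        (tensorLift ((inclR k H).comp leg₁) ((inclL k H).comp leg₁) p *
          (tensorLift ((inclL k H).comp leg₂) ((inclR k H).comp leg₂) p' *
            tensorLift ((inclR k H).comp leg₃) ((inclL k H).comp leg₃) p'')) *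
        ((inclL k H).comp leg₂ b₁ * ((inclR k H).comp leg₂ b₂ *
          ((inclR k H).comp leg₃ b₃ * (inclL k H).comp leg₃ b₄)))) =
      Q.antipodeSwap p * ((Q.S a₂ * Q.α * a₃) ⊗ₜ[k] (Q.S a₁ * Q.α * a₄)) * p' *
        ((b₁ * Q.β * Q.S b₄) ⊗ₜ[k] (b₂ * Q.β * Q.S b₃)) * Q.antipodeSwap p'' := by
  induction p using TensorProduct.induction_on with
  | zero => simp
  | add x y hx hy => simp only [map_add, add_mul, mul_add, hx, hy]
  | tmul p₁ p₂ =>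
    induction p' using TensorProduct.induction_on with
    | zero => simp
    | add x y hx hy => simp only [map_add, add_mul, mul_add, hx, hy]
    | tmul q₁ q₂ =>
      induction p'' using TensorProduct.induction_on with
      | zero => simp
      | add x y hx hy => simp only [map_add, add_mul, mul_add, hx, hy]
      | tmul r₁ r₂ => simp [Q.S_mul, mul_assoc]

theorem map_coevalEvalMap_reassoc {x y : (H ⊗[k] (H ⊗[k] H)) ⊗[k] (H ⊗[k] (H ⊗[k] H))}
    (hx : x = ∑ t, (inclR k H).comp leg₂ (Q.A1 t) * ((inclL k H).comp leg₂ (Q.A2 t) *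
      ((inclL k H).comp leg₃ (Q.A3 t) * (inclR k H).comp leg₃ (Q.A4 t))))
    (hy : y = ∑ t, (inclL k H).comp leg₁ (Q.B1 t) * ((inclR k H).comp leg₁ (Q.B2 t) *
      ((inclR k H).comp leg₂ (Q.B3 t) * (inclL k H).comp leg₂ (Q.B4 t)))) :
    TensorProduct.map Q.coevalEvalMap Q.coevalEvalMap (x *
        Q.reassoc (Q.conv ((inclL k H).comp leg₁) ((inclR k H).comp leg₁))
          (Q.conv ((inclR k H).comp leg₂) ((inclL k H).comp leg₂))
          (Q.conv ((inclL k H).comp leg₃) ((inclR k H).comp leg₃)) * y) =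
      ∑ i, Q.Δmap (Q.X1 i) * Q.delta * Q.comulAntipode (Q.X2 i) * Q.gamma * Q.Δmap (Q.X3 i) := by
  rw [QuasiBialgebra.reassoc, Finset.mul_sum, Finset.sum_mul, map_sum]
  refine Finset.sum_congr rfl fun i _ => ?_
  simp only [hx, hy, conv_def, comulAntipode_apply, delta, gamma, Finset.mul_sum, Finset.sum_mul,
    map_sum, map_coevalEvalMap_mul_mul, del1, del2, gam1, gam2]
  rw [Finset.sum_comm]

theorem comul_delta_comulAntipode_gamma :
    ∑ i, Q.Δmap (Q.X1 i) * Q.delta * Q.comulAntipode (Q.X2 i) * Q.gamma * Q.Δmap (Q.X3 i) = 1 := by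
  have hl : LeftEq (TensorProduct.map Q.coevalEvalMap Q.coevalEvalMap)
      (Q.conv ((inclL k H).comp leg₂) ((inclL k H).comp leg₃)) Q.counitMap := by
    have := Q.leftEq_coevalEvalMap.map_includeLeft (K' := Q.coevalEvalMap)
    rwa [comp_conv, comp_counitMap] at this
  have hl' : LeftEq (TensorProduct.map Q.coevalEvalMap Q.coevalEvalMap)
      (Q.conv ((inclR k H).comp leg₂) ((inclR k H).comp leg₃)) Q.counitMap := by
    have := Q.leftEq_coevalEvalMap.map_includeRight (K := Q.coevalEvalMap)
    rwa [comp_conv, comp_counitMap] at this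
  have hr : RightEq (TensorProduct.map Q.coevalEvalMap Q.coevalEvalMap)
      (Q.conv ((inclR k H).comp leg₁) ((inclR k H).comp leg₂)) Q.counitMap := by
    have := Q.rightEq_coevalEvalMap.map_includeRight (K := Q.coevalEvalMap)
    rwa [comp_conv, comp_counitMap] at this
  have hr' : RightEq (TensorProduct.map Q.coevalEvalMap Q.coevalEvalMap)
      (Q.conv ((inclL k H).comp leg₁) ((inclL k H).comp leg₂)) Q.counitMap := by
    have := Q.rightEq_coevalEvalMap.map_includeLeft (K' := Q.coevalEvalMap)
    rwa [comp_conv, comp_counitMap] at this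
  have key := Q.reassoc_two_pairs_apply ((inclL k H).comp leg₁) ((inclR k H).comp leg₁)
    ((inclR k H).comp leg₂) ((inclL k H).comp leg₂) ((inclL k H).comp leg₃) ((inclR k H).comp leg₃)
    hl hl' hr hr'
  rw [mul_assoc, ← map_reassoc, ← map_reassoc] at key
  simp only [inclL, inclR, Algebra.TensorProduct.includeLeft_apply,
    Algebra.TensorProduct.includeRight_apply, Algebra.TensorProduct.tmul_mul_tmul, one_mul,
    mul_one, TensorProduct.map_tmul, coevalEvalMap_reassoc, ← Algebra.TensorProduct.one_def] at key
  exact (Q.map_coevalEvalMap_reassoc (Q.reassoc_mul_reassocInv_conv ..)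
    (Q.reassoc_conv_mul_reassocInv ..)).symm.trans key

theorem map_evalCoevalMap_reassocInv {x y : (H ⊗[k] (H ⊗[k] H)) ⊗[k] (H ⊗[k] (H ⊗[k] H))}
    (hx : x = ∑ t, (inclR k H).comp leg₁ (Q.A1 t) * ((inclL k H).comp leg₁ (Q.A2 t) *
      ((inclL k H).comp leg₂ (Q.A3 t) * (inclR k H).comp leg₂ (Q.A4 t))))
    (hy : y = ∑ t, (inclL k H).comp leg₂ (Q.B1 t) * ((inclR k H).comp leg₂ (Q.B2 t) *
      ((inclR k H).comp leg₃ (Q.B3 t) * (inclL k H).comp leg₃ (Q.B4 t)))) :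
    TensorProduct.map Q.evalCoevalMap Q.evalCoevalMap (x *
        Q.reassocInv (Q.conv ((inclR k H).comp leg₁) ((inclL k H).comp leg₁))
          (Q.conv ((inclL k H).comp leg₂) ((inclR k H).comp leg₂))
          (Q.conv ((inclR k H).comp leg₃) ((inclL k H).comp leg₃)) * y) =
      ∑ i, Q.comulAntipode (Q.x1 i) * Q.gamma * Q.Δmap (Q.x2 i) * Q.delta *
        Q.comulAntipode (Q.x3 i) := by
  rw [QuasiBialgebra.reassocInv, Finset.mul_sum, Finset.sum_mul, map_sum]
  refine Finset.sum_congr rfl fun i _ => ?_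
  simp only [hx, hy, conv_def, comulAntipode_apply, delta, gamma, Finset.mul_sum, Finset.sum_mul,
    map_sum, map_evalCoevalMap_mul_mul, del1, del2, gam1, gam2]

theorem comulAntipode_gamma_comul_delta :
    ∑ i, Q.comulAntipode (Q.x1 i) * Q.gamma * Q.Δmap (Q.x2 i) * Q.delta *
      Q.comulAntipode (Q.x3 i) = 1 := by
  have hr : RightEq (TensorProduct.map Q.evalCoevalMap Q.evalCoevalMap)
      (Q.conv ((inclR k H).comp leg₂) ((inclR k H).comp leg₃)) Q.counitMap := by
    have := Q.rightEq_evalCoevalMap.map_includeRight (K := Q.evalCoevalMap)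
    rwa [comp_conv, comp_counitMap] at this
  have hr' : RightEq (TensorProduct.map Q.evalCoevalMap Q.evalCoevalMap)
      (Q.conv ((inclL k H).comp leg₂) ((inclL k H).comp leg₃)) Q.counitMap := by
    have := Q.rightEq_evalCoevalMap.map_includeLeft (K' := Q.evalCoevalMap)
    rwa [comp_conv, comp_counitMap] at this
  have hl : LeftEq (TensorProduct.map Q.evalCoevalMap Q.evalCoevalMap)
      (Q.conv ((inclL k H).comp leg₁) ((inclL k H).comp leg₂)) Q.counitMap := by
    have := Q.leftEq_evalCoevalMap.map_includeLeft (K' := Q.evalCoevalMap)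
    rwa [comp_conv, comp_counitMap] at this
  have hl' : LeftEq (TensorProduct.map Q.evalCoevalMap Q.evalCoevalMap)
      (Q.conv ((inclR k H).comp leg₁) ((inclR k H).comp leg₂)) Q.counitMap := by
    have := Q.leftEq_evalCoevalMap.map_includeRight (K := Q.evalCoevalMap)
    rwa [comp_conv, comp_counitMap] at this
  have key := Q.reassocInv_two_pairs_apply ((inclR k H).comp leg₁) ((inclL k H).comp leg₁)
    ((inclL k H).comp leg₂) ((inclR k H).comp leg₂) ((inclR k H).comp leg₃) ((inclL k H).comp leg₃)
    hr hr' hl hl'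
  rw [mul_assoc, ← map_reassocInv, ← map_reassocInv] at key
  simp only [inclL, inclR, Algebra.TensorProduct.includeLeft_apply,
    Algebra.TensorProduct.includeRight_apply, Algebra.TensorProduct.tmul_mul_tmul, one_mul,
    mul_one, TensorProduct.map_tmul, evalCoevalMap_reassocInv,
    ← Algebra.TensorProduct.one_def] at key
  exact (Q.map_evalCoevalMap_reassocInv (Q.reassoc_mul_reassocInv_conv ..)
    (Q.reassoc_conv_mul_reassocInv ..)).symm.trans key

end Pairing

theorem isAntipode_comulAntipode :
    Q.IsAntipode Q.Δmap Q.comulAntipode Q.gamma Q.delta where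
  map_one := by simp [comulAntipode_apply, antipodeSwap_one]
  map_mul x y := by simp [comulAntipode_apply, antipodeSwap_mul]
  eval := Q.gamma_eval
  coeval := Q.delta_coeval
  reassoc := Q.comul_delta_comulAntipode_gamma
  reassocInv := Q.comulAntipode_gamma_comul_delta

theorem isAntipode_comul_antipode :
    Q.IsAntipode Q.Δmap (Q.Δmap.toLinearMap ∘ₗ Q.S) (Q.Δmap Q.α) (Q.Δmap Q.β) :=
  Q.isAntipode_id.map Q.Δmap

/-- The Drinfeld twist `f`. -/
def twist : H ⊗[k] H := ∑ t, Q.f1 t ⊗ₜ[k] Q.f2 t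

/-- The inverse `f⁻¹` of the Drinfeld twist. -/
def twistInv : H ⊗[k] H := ∑ t, Q.g1 t ⊗ₜ[k] Q.g2 t

theorem sum_tmul_mul_sum_tmul_mul_sum_tmul {ι κ μ : Type} [Fintype ι] [Fintype κ] [Fintype μ]
    (u u' : ι → H) (v v' : κ → H) (w w' : μ → H) :
    (∑ i, u i ⊗ₜ[k] u' i) * (∑ i, v i ⊗ₜ[k] v' i) * (∑ i, w i ⊗ₜ[k] w' i) =
      ∑ p : ι × κ × μ, (u p.1 * v p.2.1 * w p.2.2) ⊗ₜ[k] (u' p.1 * v' p.2.1 * w' p.2.2) := by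
  simp only [Finset.sum_mul, Finset.mul_sum, Algebra.TensorProduct.tmul_mul_tmul,
    Fintype.sum_prod_type]
  rw [Finset.sum_comm_cycle]
  exact Finset.sum_congr rfl fun i _ => Finset.sum_comm

theorem antipodeSwap_comul (h : H) :
    Q.antipodeSwap (Q.Δmap h) = ∑ j, Q.S (Q.Δ2 h j) ⊗ₜ[k] Q.S (Q.Δ1 h j) := by
  simp [Q.Δ_eq]

theorem twist_eq_transfer : Q.twist =
    Q.transfer Q.Δmap Q.comulAntipode Q.gamma (Q.Δmap Q.β) (Q.Δmap.toLinearMap ∘ₗ Q.S) := by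
  rw [twist, Fintype.sum_prod_type]
  refine Finset.sum_congr rfl fun i _ => ?_
  have h : Q.comulAntipode (Q.x1 i) * Q.gamma * Q.Δmap (Q.x2 i) * Q.Δmap Q.β *
      Q.Δmap (Q.S (Q.x3 i)) =
      Q.antipodeSwap (Q.Δmap (Q.x1 i)) * Q.gamma * Q.Δmap (Q.x2 i * Q.β * Q.S (Q.x3 i)) := by
    simp only [map_mul, mul_assoc, comulAntipode_apply]
  refine Eq.trans ?_ h.symm
  rw [antipodeSwap_comul, gamma, Q.Δ_eq (_ * _)]
  rw [sum_tmul_mul_sum_tmul_mul_sum_tmul]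
  rfl

theorem twistInv_eq_transfer : Q.twistInv =
    Q.transfer Q.Δmap (Q.Δmap.toLinearMap ∘ₗ Q.S) (Q.Δmap Q.α) Q.delta Q.comulAntipode := by
  rw [twistInv, Fintype.sum_prod_type]
  refine Finset.sum_congr rfl fun i _ => ?_
  have h : Q.Δmap (Q.S (Q.x1 i)) * Q.Δmap Q.α * Q.Δmap (Q.x2 i) * Q.delta *
      Q.comulAntipode (Q.x3 i) =
      Q.Δmap (Q.S (Q.x1 i) * Q.α * Q.x2 i) * Q.delta * Q.antipodeSwap (Q.Δmap (Q.x3 i)) := by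
    simp only [map_mul, mul_assoc, comulAntipode_apply]
  refine Eq.trans ?_ h.symm
  rw [antipodeSwap_comul, delta, Q.Δ_eq (_ * _)]
  rw [sum_tmul_mul_sum_tmul_mul_sum_tmul]
  rfl

theorem twist_mul_twistInv : Q.twist * Q.twistInv = 1 := by
  rw [twist_eq_transfer, twistInv_eq_transfer]
  exact Q.isAntipode_comul_antipode.transfer_mul_transfer Q.isAntipode_comulAntipode

theorem twistInv_mul_twist : Q.twistInv * Q.twist = 1 := by
  rw [twist_eq_transfer, twistInv_eq_transfer]
  exact Q.isAntipode_comulAntipode.transfer_mul_transfer Q.isAntipode_comul_antipode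

theorem twist_mul_comul_antipode (h : H) :
    Q.twist * Q.Δmap (Q.S h) = Q.antipodeSwap (Q.Δmap h) * Q.twist := by
  rw [twist_eq_transfer]
  exact Q.isAntipode_comul_antipode.transfer_mul Q.isAntipode_comulAntipode h

theorem twist_mul_comul_alpha : Q.twist * Q.Δmap Q.α = Q.gamma := by
  rw [twist_eq_transfer]
  exact Q.isAntipode_comul_antipode.transfer_mul_eval Q.isAntipode_comulAntipode

section TwistLegs

variable (φ ψ : H →ₐ[k] T) [Commuting φ ψ]

theorem tensorLift_twist_mul_conv (h : H) : tensorLift φ ψ Q.twist * Q.conv φ ψ (Q.S h) =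
    tensorLift φ ψ (Q.antipodeSwap (Q.Δmap h)) * tensorLift φ ψ Q.twist := by
  rw [conv_def, ← map_mul, twist_mul_comul_antipode, map_mul]

theorem tensorLift_twist_mul_conv_mul_alpha_mul (x y : H) :
    tensorLift φ ψ Q.twist * Q.conv φ ψ (Q.S x * Q.α * y) =
      tensorLift φ ψ (Q.antipodeSwap (Q.Δmap x) * Q.gamma * Q.Δmap y) := by
  rw [conv_def, ← map_mul]
  congr 1
  rw [map_mul, map_mul, ← mul_assoc, ← mul_assoc,
    twist_mul_comul_antipode, mul_assoc (Q.antipodeSwap _), twist_mul_comul_alpha]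

theorem tensorLift_twist_mul_conv_alpha :
    tensorLift φ ψ Q.twist * Q.conv φ ψ Q.α = tensorLift φ ψ Q.gamma := by
  rw [conv_def, ← map_mul, twist_mul_comul_alpha]

theorem tensorLift_mul_comm (χ : H →ₐ[k] T) [Commuting φ χ] [Commuting ψ χ] (z : H ⊗[k] H)
    (h : H) : tensorLift φ ψ z * χ h = χ h * tensorLift φ ψ z :=
  Commuting.mul_comm (tensorLift φ ψ) χ z h

end TwistLegs

/-- The anti-multiplicative map `x ⊗ y ⊗ z ↦ S z ⊗ S y ⊗ S x`. -/
def antipodeRev : H ⊗[k] (H ⊗[k] H) →ₗ[k] H ⊗[k] (H ⊗[k] H) :=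
  (TensorProduct.assoc k H H H).toLinearMap ∘ₗ TensorProduct.map Q.antipodeSwap Q.S ∘ₗ
    (TensorProduct.comm k H (H ⊗[k] H)).toLinearMap

@[simp]
theorem antipodeRev_tmul (x y z : H) : Q.antipodeRev (x ⊗ₜ[k] (y ⊗ₜ[k] z)) =
    Q.S z ⊗ₜ[k] (Q.S y ⊗ₜ[k] Q.S x) := by
  simp [antipodeRev]

theorem antipodeRev_mul (x y : H ⊗[k] (H ⊗[k] H)) :
    Q.antipodeRev (x * y) = Q.antipodeRev y * Q.antipodeRev x := by
  suffices Q.antipodeRev ∘ₗ LinearMap.mulLeft k x =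
    LinearMap.mulRight k (Q.antipodeRev x) ∘ₗ Q.antipodeRev from LinearMap.congr_fun this y
  ext a b c
  suffices Q.antipodeRev ∘ₗ LinearMap.mulRight k (a ⊗ₜ[k] (b ⊗ₜ[k] c)) =
    LinearMap.mulLeft k (Q.antipodeRev (a ⊗ₜ[k] (b ⊗ₜ[k] c))) ∘ₗ Q.antipodeRev from
    LinearMap.congr_fun this x
  ext a' b' c'
  simp [Q.S_mul]

theorem antipodeRev_leg₁_mul (a : H) (z : H ⊗[k] H) :
    Q.antipodeRev (leg₁ a * tensorLift leg₂ leg₃ z) =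
      tensorLift leg₁ leg₂ (Q.antipodeSwap z) * leg₃ (Q.S a) := by
  induction z using TensorProduct.induction_on with
  | zero => simp
  | add x y hx hy => simp only [map_add, mul_add, add_mul, hx, hy]
  | tmul x y => simp

theorem antipodeRev_mul_leg₃ (a : H) (z : H ⊗[k] H) :
    Q.antipodeRev (tensorLift leg₁ leg₂ z * leg₃ a) =
      leg₁ (Q.S a) * tensorLift leg₂ leg₃ (Q.antipodeSwap z) := by
  induction z using TensorProduct.induction_on with
  | zero => simp
  | add x y hx hy => simp only [map_add, mul_add, add_mul, hx, hy]
  | tmul x y => simp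

theorem antipodeRev_leg₁_mul_conv (a b : H) :
    Q.antipodeRev (leg₁ a * Q.conv leg₂ leg₃ b) =
      tensorLift leg₁ leg₂ (Q.antipodeSwap (Q.Δmap b)) * leg₃ (Q.S a) :=
  Q.antipodeRev_leg₁_mul a (Q.Δmap b)

theorem antipodeRev_conv_mul_leg₃ (a b : H) :
    Q.antipodeRev (Q.conv leg₁ leg₂ a * leg₃ b) =
      leg₁ (Q.S b) * tensorLift leg₂ leg₃ (Q.antipodeSwap (Q.Δmap a)) :=
  Q.antipodeRev_mul_leg₃ b (Q.Δmap a)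

theorem semiconjBy_antipodeRev_reassoc (h : H) :
    SemiconjBy (Q.antipodeRev (Q.reassoc leg₁ leg₂ leg₃))
      (Q.antipodeRev (Q.conv leg₁ (Q.conv leg₂ leg₃) h))
      (Q.antipodeRev (Q.conv (Q.conv leg₁ leg₂) leg₃ h)) := by
  rw [SemiconjBy, ← antipodeRev_mul, ← antipodeRev_mul, conv_assoc_mul_reassoc]

theorem semiconjBy_twist_left (h : H) :
    SemiconjBy (tensorLift leg₁ leg₂ Q.twist * tensorLift (Q.conv leg₁ leg₂) leg₃ Q.twist)
      (Q.conv (Q.conv leg₁ leg₂) leg₃ (Q.S h))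
      (Q.antipodeRev (Q.conv leg₁ (Q.conv leg₂ leg₃) h)) := by
  have h1 : SemiconjBy (tensorLift leg₁ leg₂ Q.twist)
      (tensorLift (Q.conv leg₁ leg₂) leg₃ (Q.antipodeSwap (Q.Δmap h)))
      (Q.antipodeRev (Q.conv leg₁ (Q.conv leg₂ leg₃) h)) := by
    rw [SemiconjBy, antipodeSwap_comul, conv_apply, map_sum, map_sum, Finset.mul_sum,
      Finset.sum_mul]
    refine Finset.sum_congr rfl fun j _ => ?_
    rw [tensorLift_tmul, ← mul_assoc, tensorLift_twist_mul_conv, antipodeRev_leg₁_mul_conv,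
      mul_assoc, mul_assoc]
    congr 1
    exact tensorLift_mul_comm _ _ _ _ _
  exact h1.mul_left (Q.tensorLift_twist_mul_conv _ _ h)

theorem semiconjBy_twist_right (h : H) :
    SemiconjBy (tensorLift leg₂ leg₃ Q.twist * tensorLift leg₁ (Q.conv leg₂ leg₃) Q.twist *
        Q.reassoc leg₁ leg₂ leg₃)
      (Q.conv (Q.conv leg₁ leg₂) leg₃ (Q.S h))
      (Q.antipodeRev (Q.conv (Q.conv leg₁ leg₂) leg₃ h)) := by
  have h1 : SemiconjBy (tensorLift leg₂ leg₃ Q.twist)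
      (tensorLift leg₁ (Q.conv leg₂ leg₃) (Q.antipodeSwap (Q.Δmap h)))
      (Q.antipodeRev (Q.conv (Q.conv leg₁ leg₂) leg₃ h)) := by
    rw [SemiconjBy, antipodeSwap_comul, conv_apply, map_sum, map_sum, Finset.mul_sum,
      Finset.sum_mul]
    refine Finset.sum_congr rfl fun j _ => ?_
    rw [tensorLift_tmul, antipodeRev_conv_mul_leg₃, mul_assoc,
      ← tensorLift_twist_mul_conv, ← mul_assoc, ← mul_assoc]
    congr 1
    exact tensorLift_mul_comm _ _ _ _ _
  exact (h1.mul_left (Q.tensorLift_twist_mul_conv _ _ h)).mul_left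
    (Q.semiconjBy_reassoc_conv _ _ _ _)

section Triple

variable (k H) in
/-- The left factor of the first pair. -/
abbrev pairLeft₁ : H →ₐ[k] (H ⊗[k] H) ⊗[k] ((H ⊗[k] H) ⊗[k] (H ⊗[k] H)) :=
  Algebra.TensorProduct.includeLeft.comp Algebra.TensorProduct.includeLeft

variable (k H) in
/-- The right factor of the first pair. -/
abbrev pairRight₁ : H →ₐ[k] (H ⊗[k] H) ⊗[k] ((H ⊗[k] H) ⊗[k] (H ⊗[k] H)) :=
  Algebra.TensorProduct.includeLeft.comp Algebra.TensorProduct.includeRight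

variable (k H) in
/-- The left factor of the second pair. -/
abbrev pairLeft₂ : H →ₐ[k] (H ⊗[k] H) ⊗[k] ((H ⊗[k] H) ⊗[k] (H ⊗[k] H)) :=
  Algebra.TensorProduct.includeRight.comp
    (Algebra.TensorProduct.includeLeft.comp Algebra.TensorProduct.includeLeft)

variable (k H) in
/-- The right factor of the second pair. -/
abbrev pairRight₂ : H →ₐ[k] (H ⊗[k] H) ⊗[k] ((H ⊗[k] H) ⊗[k] (H ⊗[k] H)) :=
  Algebra.TensorProduct.includeRight.comp
    (Algebra.TensorProduct.includeLeft.comp Algebra.TensorProduct.includeRight)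

variable (k H) in
/-- The left factor of the third pair. -/
abbrev pairLeft₃ : H →ₐ[k] (H ⊗[k] H) ⊗[k] ((H ⊗[k] H) ⊗[k] (H ⊗[k] H)) :=
  Algebra.TensorProduct.includeRight.comp
    (Algebra.TensorProduct.includeRight.comp Algebra.TensorProduct.includeLeft)

variable (k H) in
/-- The right factor of the third pair. -/
abbrev pairRight₃ : H →ₐ[k] (H ⊗[k] H) ⊗[k] ((H ⊗[k] H) ⊗[k] (H ⊗[k] H)) :=
  Algebra.TensorProduct.includeRight.comp
    (Algebra.TensorProduct.includeRight.comp Algebra.TensorProduct.includeRight)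

/-- The map `(c ⊗ d) ⊗ ((b ⊗ e) ⊗ (a ⊗ f)) ↦ S c * α * d ⊗ S b * α * e ⊗ S a * α * f`. -/
def evalMap₃ : (H ⊗[k] H) ⊗[k] ((H ⊗[k] H) ⊗[k] (H ⊗[k] H)) →ₗ[k] H ⊗[k] (H ⊗[k] H) :=
  TensorProduct.map Q.evalMap (TensorProduct.map Q.evalMap Q.evalMap)

theorem evalMap₃_mul_mul_left (y1 y2 y3 y4 x2 x3 z1 z2 z3 : H) (P P' : H ⊗[k] H) :
    Q.evalMap₃ ((pairLeft₃ k H y1 * (pairLeft₂ k H y2 * (pairRight₂ k H y3 * pairRight₃ k H y4))) *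
      (tensorLift (pairLeft₃ k H) (pairLeft₂ k H) P * (pairLeft₁ k H x2 * (pairRight₁ k H x3 *
        tensorLift (pairRight₂ k H) (pairRight₃ k H) P'))) *
      (pairRight₁ k H z1 * (pairRight₂ k H z2 * pairRight₃ k H z3))) =
    leg₁ (Q.S x2 * Q.α * x3) * tensorLift leg₂ leg₃ (Q.antipodeSwap P *
      ((Q.S y2 * Q.α * y3) ⊗ₜ[k] (Q.S y1 * Q.α * y4)) * P') *
      (leg₁ z1 * (leg₂ z2 * leg₃ z3)) := by
  induction P using TensorProduct.induction_on with
  | zero => simp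
  | add x y hx hy => simp only [map_add, mul_add, add_mul, hx, hy]
  | tmul p q =>
    induction P' using TensorProduct.induction_on with
    | zero => simp
    | add x y hx hy => simp only [map_add, mul_add, add_mul, hx, hy]
    | tmul p' q' => simp [evalMap₃, Q.S_mul, mul_assoc]

theorem evalMap₃_mul_mul_right (y1 y2 y3 y4 x1 x4 z1 z2 z3 : H) (P P' : H ⊗[k] H) :
    Q.evalMap₃ ((pairLeft₂ k H y1 * (pairLeft₁ k H y2 * (pairRight₁ k H y3 * pairRight₂ k H y4))) *
      (pairLeft₃ k H x1 * (tensorLift (pairLeft₂ k H) (pairLeft₁ k H) P *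
        (tensorLift (pairRight₁ k H) (pairRight₂ k H) P' * pairRight₃ k H x4))) *
      (pairLeft₃ k H z1 * (pairLeft₂ k H z2 * pairLeft₁ k H z3))) =
    Q.antipodeRev (leg₁ z1 * (leg₂ z2 * leg₃ z3)) *
      (tensorLift leg₁ leg₂ (Q.antipodeSwap P *
        ((Q.S y2 * Q.α * y3) ⊗ₜ[k] (Q.S y1 * Q.α * y4)) * P') *
      leg₃ (Q.S x1 * Q.α * x4)) := by
  induction P using TensorProduct.induction_on with
  | zero => simp
  | add x y hx hy => simp only [map_add, mul_add, add_mul, hx, hy]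
  | tmul p q =>
    induction P' using TensorProduct.induction_on with
    | zero => simp
    | add x y hx hy => simp only [map_add, mul_add, add_mul, hx, hy]
    | tmul p' q' => simp [evalMap₃, Q.S_mul, mul_assoc]

theorem evalMap₃_reassoc_left {x y : (H ⊗[k] H) ⊗[k] ((H ⊗[k] H) ⊗[k] (H ⊗[k] H))}
    (hx : x = ∑ t, pairLeft₃ k H (Q.A1 t) * (pairLeft₂ k H (Q.A2 t) *
      (pairRight₂ k H (Q.A3 t) * pairRight₃ k H (Q.A4 t))))
    (hy : y = ∑ t, Q.conv (pairLeft₃ k H) (pairLeft₂ k H) (Q.A1 t) * (pairLeft₁ k H (Q.A2 t) *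
      (pairRight₁ k H (Q.A3 t) * Q.conv (pairRight₂ k H) (pairRight₃ k H) (Q.A4 t)))) :
    Q.evalMap₃ (x * y * Q.reassoc (pairRight₁ k H) (pairRight₂ k H) (pairRight₃ k H)) =
      (∑ s, leg₁ (Q.gam1 s) * tensorLift leg₂ leg₃ (Q.antipodeSwap (Q.Δmap (Q.A1 s)) * Q.gamma *
        Q.Δmap (Q.A4 s))) * Q.reassoc leg₁ leg₂ leg₃ := by
  simp only [hx, hy, conv_def, QuasiBialgebra.reassoc, gamma, Finset.mul_sum, Finset.sum_mul,
    map_sum, evalMap₃_mul_mul_left, gam1, gam2]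

theorem evalMap₃_reassoc_right {x y : (H ⊗[k] H) ⊗[k] ((H ⊗[k] H) ⊗[k] (H ⊗[k] H))}
    (hx : x = ∑ t, pairLeft₂ k H (Q.A1 t) * (pairLeft₁ k H (Q.A2 t) *
      (pairRight₁ k H (Q.A3 t) * pairRight₂ k H (Q.A4 t))))
    (hy : y = ∑ t, pairLeft₃ k H (Q.A1 t) * (Q.conv (pairLeft₂ k H) (pairLeft₁ k H) (Q.A2 t) *
      (Q.conv (pairRight₁ k H) (pairRight₂ k H) (Q.A3 t) * pairRight₃ k H (Q.A4 t)))) :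
    Q.evalMap₃ (x * y * Q.reassoc (pairLeft₃ k H) (pairLeft₂ k H) (pairLeft₁ k H)) =
      Q.antipodeRev (Q.reassoc leg₁ leg₂ leg₃) *
        ∑ s, tensorLift leg₁ leg₂ (Q.antipodeSwap (Q.Δmap (Q.A2 s)) * Q.gamma *
          Q.Δmap (Q.A3 s)) * leg₃ (Q.gam2 s) := by
  simp only [hx, hy, conv_def, QuasiBialgebra.reassoc, gamma, Finset.mul_sum, Finset.sum_mul,
    map_sum, evalMap₃_mul_mul_right, gam1, gam2]
  exact Finset.sum_comm_cycle.symm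

theorem leg₁_mul_tensorLift_mul_reassoc :
    (∑ s, leg₁ (Q.gam1 s) * tensorLift leg₂ leg₃ (Q.antipodeSwap (Q.Δmap (Q.A1 s)) * Q.gamma *
        Q.Δmap (Q.A4 s))) * Q.reassoc leg₁ leg₂ leg₃ =
      Q.antipodeRev (Q.reassoc leg₁ leg₂ leg₃) *
        ∑ s, tensorLift leg₁ leg₂ (Q.antipodeSwap (Q.Δmap (Q.A2 s)) * Q.gamma *
          Q.Δmap (Q.A3 s)) * leg₃ (Q.gam2 s) := by
  have h : LeftEq Q.evalMap₃ (Q.conv (pairLeft₁ k H) (pairRight₁ k H)) Q.counitMap := by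
    have := Q.leftEq_evalMap.map_includeLeft (K' := TensorProduct.map Q.evalMap Q.evalMap)
    rwa [comp_conv, comp_counitMap] at this
  have key := Q.reassoc_three_pairs_apply (pairLeft₃ k H) (pairLeft₂ k H) (pairLeft₁ k H)
    (pairRight₁ k H) (pairRight₂ k H) (pairRight₃ k H) h
  rw [mul_assoc (_ * _) (Q.reassoc _ _ _) (Q.reassocInv _ _ _),
    mul_assoc (Q.reassoc _ _ _ * _) (Q.reassoc _ _ _) (Q.reassocInv _ _ _)] at key
  exact (Q.evalMap₃_reassoc_left (Q.reassoc_mul_reassocInv_conv ..)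
    (Q.reassoc_mul_reassocInv_conv ..)).symm.trans (key.trans
      (Q.evalMap₃_reassoc_right (Q.reassoc_mul_reassocInv_conv ..)
        (Q.reassoc_mul_reassocInv_conv ..)))

end Triple

section TwistCocycle

variable (φ ψ χ : H →ₐ[k] T) [Commuting φ ψ] [Commuting φ χ] [Commuting ψ χ]

theorem tensorLift_twist_mul_sum_left :
    tensorLift ψ χ Q.twist * tensorLift φ (Q.conv ψ χ) Q.twist * Q.conv φ (Q.conv ψ χ) Q.α =
      ∑ s, φ (Q.gam1 s) * tensorLift ψ χ (Q.antipodeSwap (Q.Δmap (Q.A1 s)) * Q.gamma *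
        Q.Δmap (Q.A4 s)) := by
  rw [mul_assoc, tensorLift_twist_mul_conv_alpha, gamma, map_sum, Finset.mul_sum]
  refine Finset.sum_congr rfl fun s _ => ?_
  rw [tensorLift_tmul, ← mul_assoc, tensorLift_mul_comm, mul_assoc]
  exact congrArg _ (Q.tensorLift_twist_mul_conv_mul_alpha_mul ψ χ _ _)

theorem tensorLift_twist_mul_sum_right :
    tensorLift φ ψ Q.twist * tensorLift (Q.conv φ ψ) χ Q.twist * Q.conv (Q.conv φ ψ) χ Q.α =
      ∑ s, tensorLift φ ψ (Q.antipodeSwap (Q.Δmap (Q.A2 s)) * Q.gamma *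
        Q.Δmap (Q.A3 s)) * χ (Q.gam2 s) := by
  rw [mul_assoc, tensorLift_twist_mul_conv_alpha, gamma, map_sum, Finset.mul_sum]
  refine Finset.sum_congr rfl fun s _ => ?_
  rw [tensorLift_tmul, ← mul_assoc]
  exact congrArg (· * _) (Q.tensorLift_twist_mul_conv_mul_alpha_mul φ ψ _ _)

end TwistCocycle

/-- The compatibility of the Drinfeld twist with the reassociator. -/
theorem twist_mul_twist_mul_reassoc :
    tensorLift leg₂ leg₃ Q.twist * tensorLift leg₁ (Q.conv leg₂ leg₃) Q.twist *
        Q.reassoc leg₁ leg₂ leg₃ =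
      Q.antipodeRev (Q.reassoc leg₁ leg₂ leg₃) *
        (tensorLift leg₁ leg₂ Q.twist * tensorLift (Q.conv leg₁ leg₂) leg₃ Q.twist) := by
  refine (Q.isAntipode_id.map (Q.conv (Q.conv leg₁ leg₂) leg₃)).eq_of_semiconj
    Q.semiconjBy_twist_right
    (fun h => (Q.semiconjBy_antipodeRev_reassoc h).mul_left (Q.semiconjBy_twist_left h)) ?_
  rw [mul_assoc (Q.antipodeRev _), tensorLift_twist_mul_sum_right,
    ← leg₁_mul_tensorLift_mul_reassoc, ← tensorLift_twist_mul_sum_left, mul_assoc,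
    ← conv_assoc_mul_reassoc]
  simp only [mul_assoc]

theorem reassoc_mul_twistInv :
    Q.reassoc leg₁ leg₂ leg₃ * tensorLift (Q.conv leg₁ leg₂) leg₃ Q.twistInv =
      tensorLift leg₁ (Q.conv leg₂ leg₃) Q.twistInv * tensorLift leg₂ leg₃ Q.twistInv *
        Q.antipodeRev (Q.reassoc leg₁ leg₂ leg₃) * tensorLift leg₁ leg₂ Q.twist := by
  have h {φ ψ : H →ₐ[k] H ⊗[k] (H ⊗[k] H)} [Commuting φ ψ] :
      tensorLift φ ψ Q.twistInv * tensorLift φ ψ Q.twist = 1 := by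
    rw [← map_mul, twistInv_mul_twist, map_one]
  have h' {φ ψ : H →ₐ[k] H ⊗[k] (H ⊗[k] H)} [Commuting φ ψ] :
      tensorLift φ ψ Q.twist * tensorLift φ ψ Q.twistInv = 1 := by
    rw [← map_mul, twist_mul_twistInv, map_one]
  have key := congrArg (tensorLift leg₁ (Q.conv leg₂ leg₃) Q.twistInv *
    tensorLift leg₂ leg₃ Q.twistInv * · * tensorLift (Q.conv leg₁ leg₂) leg₃ Q.twistInv)
    Q.twist_mul_twist_mul_reassoc
  calc _ = tensorLift leg₁ (Q.conv leg₂ leg₃) Q.twistInv *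
        (tensorLift leg₂ leg₃ Q.twistInv * tensorLift leg₂ leg₃ Q.twist) *
        tensorLift leg₁ (Q.conv leg₂ leg₃) Q.twist * Q.reassoc leg₁ leg₂ leg₃ *
        tensorLift (Q.conv leg₁ leg₂) leg₃ Q.twistInv := by rw [h, mul_one, h, one_mul]
    _ = _ := by simpa only [mul_assoc] using key
    _ = tensorLift leg₁ (Q.conv leg₂ leg₃) Q.twistInv * tensorLift leg₂ leg₃ Q.twistInv *
        Q.antipodeRev (Q.reassoc leg₁ leg₂ leg₃) * tensorLift leg₁ leg₂ Q.twist *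
        (tensorLift (Q.conv leg₁ leg₂) leg₃ Q.twist *
          tensorLift (Q.conv leg₁ leg₂) leg₃ Q.twistInv) := by simp only [mul_assoc]
    _ = _ := by rw [h', mul_one]

end QuasiHopf

open QuasiBialgebra QuasiHopf

/-- Lemma 4.1, identity (l2):
`Φ·(Δ⊗id)(f⁻¹) = ∑ g¹S(X³)f¹ ⊗ g²₁G¹S(X²)f² ⊗ g²₂G²S(X¹)`,
where `f = ∑ f¹⊗f²` is the Drinfeld twist and `f⁻¹ = ∑ g¹⊗g² = ∑ G¹⊗G²`. -/
theorem phi_comul_twist_inv_identity {k H : Type} [Field k] [Ring H] [Algebra k H]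
    (Q : QuasiHopf k H) :
    (∑ i, Q.X1 i ⊗ₜ[k] (Q.X2 i ⊗ₜ[k] Q.X3 i))
        * (∑ t : Q.GIdx, ∑ j, Q.Δ1 (Q.g1 t) j ⊗ₜ[k] (Q.Δ2 (Q.g1 t) j ⊗ₜ[k] Q.g2 t))
      = ∑ t : Q.GIdx, ∑ t' : Q.GIdx, ∑ i, ∑ c : Q.FIdx, ∑ j,
          (Q.g1 t * Q.S (Q.X3 i) * Q.f1 c)
            ⊗ₜ[k] ((Q.Δ1 (Q.g2 t) j * Q.g1 t' * Q.S (Q.X2 i) * Q.f2 c)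
              ⊗ₜ[k] (Q.Δ2 (Q.g2 t) j * Q.g2 t' * Q.S (Q.X1 i))) := by
  have h1 : Q.reassoc leg₁ leg₂ leg₃ = ∑ i, Q.X1 i ⊗ₜ[k] (Q.X2 i ⊗ₜ[k] Q.X3 i) := by
    simp [QuasiBialgebra.reassoc]
  have h2 : tensorLift (Q.conv leg₁ leg₂) leg₃ Q.twistInv =
      ∑ t, ∑ j, Q.Δ1 (Q.g1 t) j ⊗ₜ[k] (Q.Δ2 (Q.g1 t) j ⊗ₜ[k] Q.g2 t) := by
    simp [twistInv, conv_apply, Finset.sum_mul]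
  have h3 : tensorLift leg₁ (Q.conv leg₂ leg₃) Q.twistInv =
      ∑ t, ∑ j, Q.g1 t ⊗ₜ[k] (Q.Δ1 (Q.g2 t) j ⊗ₜ[k] Q.Δ2 (Q.g2 t) j) := by
    simp [twistInv, conv_apply, Finset.mul_sum]
  have h4 : tensorLift leg₂ leg₃ Q.twistInv =
      ∑ t, (1 : H) ⊗ₜ[k] (Q.g1 t ⊗ₜ[k] Q.g2 t) := by
    simp [twistInv]
  have h5 : tensorLift leg₁ leg₂ Q.twist =
      ∑ c, Q.f1 c ⊗ₜ[k] (Q.f2 c ⊗ₜ[k] (1 : H)) := by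
    simp [twist]
  have key := Q.reassoc_mul_twistInv
  rw [h2, h3, h4, h5, h1] at key
  rw [key]
  simp only [map_sum, antipodeRev_tmul]
  simp only [Finset.sum_mul, Finset.mul_sum, Algebra.TensorProduct.tmul_mul_tmul, mul_one]
  refine (Finset.sum_congr rfl fun _ _ => Finset.sum_comm_cycle).trans (Finset.sum_comm.trans ?_)
  refine Finset.sum_congr rfl fun t _ => Finset.sum_comm_cycle.trans ?_
  exact Finset.sum_congr rfl fun t' _ => Finset.sum_comm
end
end
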